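/- arXiv:1708.01782 — 2 statements merged into one kernel-verified Lean document; each statement's English description precedes it below -/
import Mathlib

section
/- Let F be a field of characteristic different from two, and let p and q be forms over F of dimension at least two. Over K = F((x₁))…((xₙ)), let π ≅ ⟨1,−x₁⟩⊗…⊗⟨1,−xₙ⟩. Then the Witt index of π ⊗ q over the function field K(π ⊗ p) equals (dim π) · i(q_{F(p)}). -/
set_option synthInstance.maxHeartbeats 1000000
set_option maxHeartbeats 4000000

open scoped BigOperators Classical

namespace QF

section Defs

variable {R : Type*} [CommRing R]

/-- Evaluation of the diagonal quadratic form with coefficients `d` at the vector `v`. -/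
def evalQF {n : ℕ} (d : Fin n → R) (v : Fin n → R) : R := ∑ i, d i * v i ^ 2

/-- A form is isotropic if it represents zero non-trivially. -/
def Isotropic {n : ℕ} (d : Fin n → R) : Prop := ∃ v : Fin n → R, v ≠ 0 ∧ evalQF d v = 0

def Anisotropic {n : ℕ} (d : Fin n → R) : Prop := ¬ Isotropic d

/-- Nondegeneracy of a diagonal form: all coefficients are nonzero. -/
def Nondeg {n : ℕ} (d : Fin n → R) : Prop := ∀ i, d i ≠ 0

/-- Two diagonal forms are isometric if a linear equivalence matches their values. -/
def Isometric {m n : ℕ} (d : Fin m → R) (e : Fin n → R) : Prop :=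
  ∃ φ : (Fin m → R) ≃ₗ[R] (Fin n → R), ∀ v, evalQF e (φ v) = evalQF d v

/-- Orthogonal sum of diagonal forms. -/
def osum {m n : ℕ} (d : Fin m → R) (e : Fin n → R) : Fin (m + n) → R := Fin.append d e

/-- Tensor product of diagonal forms. -/
def tensorQF {m n : ℕ} (d : Fin m → R) (e : Fin n → R) : Fin (m * n) → R :=
  fun i => d (finProdFinEquiv.symm i).1 * e (finProdFinEquiv.symm i).2

/-- Scaling of a form by a scalar. -/
def smulQF {n : ℕ} (a : R) (d : Fin n → R) : Fin n → R := fun i => a * d i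

/-- `k` copies of the hyperbolic plane `⟨1,-1⟩`. -/
def hypform {R : Type*} [CommRing R] (k : ℕ) : Fin (k + k) → R :=
  Fin.append (fun _ => 1) (fun _ => -1)

/-- A form is hyperbolic if it is isometric to a sum of hyperbolic planes,
i.e. its Witt index is half its dimension. -/
def IsHyperbolic {n : ℕ} (d : Fin n → R) : Prop := ∃ k : ℕ, Isometric d (hypform k)

/-- The Witt index: the largest `k` such that `d ≅ k×⟨1,-1⟩ ⊥ r`. -/
noncomputable def WittIndex {n : ℕ} (d : Fin n → R) : ℕ :=
  sSup {k : ℕ | ∃ (m : ℕ) (r : Fin m → R), Isometric d (osum (hypform k) r)}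

/-- `r` is a subform of `d`: `d ≅ r ⊥ s` for some (nondegenerate) form `s`. -/
def Subform {m n : ℕ} (r : Fin m → R) (d : Fin n → R) : Prop :=
  ∃ (k : ℕ) (s : Fin k → R), Nondeg s ∧ Isometric d (osum r s)

/-- The set of nonzero represented values. -/
def Dset {n : ℕ} (d : Fin n → R) : Set R :=
  {a | a ≠ 0 ∧ ∃ v : Fin n → R, evalQF d v = a}

/-- The group of similarity factors `G(q) = {a : a·q ≅ q}`. -/
def Gset {n : ℕ} (d : Fin n → R) : Set R :=
  {a | a ≠ 0 ∧ Isometric (smulQF a d) d}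

/-- `H(q) = {a : ⟨1,-a⟩ ⊗ q is isotropic}`. -/
def Hset {n : ℕ} (d : Fin n → R) : Set R :=
  {a | a ≠ 0 ∧ Isotropic (tensorQF ![1, -a] d)}

/-- Base change of a form along a ring homomorphism (e.g. a field extension). -/
def bc {S : Type*} [CommRing S] (f : R →+* S) {n : ℕ} (d : Fin n → R) : Fin n → S :=
  fun i => f (d i)

/-- The Pfister form `⟨1,a 0⟩ ⊗ ⋯ ⊗ ⟨1, a (n-1)⟩`: its `2^n` diagonal coefficients are
the products `∏_{j ∈ S} a j` over subsets `S` of the index set. -/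
noncomputable def pfisterOf {n : ℕ} (a : Fin n → R) : Fin (2 ^ n) → R :=
  fun i => ∏ j : Fin n, if (finFunctionFinEquiv.symm i) j = 0 then 1 else a j

/-- `π` is an `n`-fold Pfister form. -/
def IsNPfister (n : ℕ) {m : ℕ} (π : Fin m → R) : Prop :=
  ∃ a : Fin n → R, (∀ i, a i ≠ 0) ∧ Isometric π (pfisterOf a)

/-- `π` is a Pfister form. -/
def IsPfister {m : ℕ} (π : Fin m → R) : Prop := ∃ n : ℕ, IsNPfister n π

end Defs

/-- The quadric polynomial `p(X₁,…,Xₙ) = ∑ dᵢ Xᵢ²` attached to a diagonal form. -/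
noncomputable def formPoly {F : Type*} [CommRing F] {n : ℕ} (d : Fin n → F) :
    MvPolynomial (Fin n) F :=
  ∑ i, MvPolynomial.C (d i) * MvPolynomial.X i ^ 2

/-- The affine coordinate ring `F[X₁,…,Xₙ]/(p(X))` of the quadric `p = 0`. -/
abbrev CoordRing {F : Type*} [CommRing F] {n : ℕ} (d : Fin n → F) : Type _ :=
  MvPolynomial (Fin n) F ⧸ Ideal.span {formPoly d}

/-- The function field `F(p)` of the quadric `p = 0`: the total fraction ring of the
coordinate ring (the quotient field when the coordinate ring is a domain, i.e. when `p` is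
anisotropic of dimension at least 2). -/
abbrev FunField {F : Type*} [Field F] {n : ℕ} (d : Fin n → F) : Type _ :=
  FractionRing (CoordRing d)

end QF


namespace QF

universe u

/-- The iterated Laurent series field `F((x₁))…((xₙ))`, together with its field structure. -/
noncomputable def IterLaurentAux (F : Type u) [Field F] : ℕ → (K : Type u) × Field K
  | 0 => ⟨F, inferInstance⟩
  | n + 1 =>
      letI := (IterLaurentAux F n).2
      ⟨LaurentSeries (IterLaurentAux F n).1, inferInstance⟩

/-- The iterated Laurent series field `F((x₁))…((xₙ))`. -/
noncomputable def IterLaurent (F : Type u) [Field F] (n : ℕ) : Type u :=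
  (IterLaurentAux F n).1

noncomputable instance {F : Type u} [Field F] (n : ℕ) : Field (IterLaurent F n) :=
  (IterLaurentAux F n).2

/-- The canonical embedding `F → F((x₁))…((xₙ))`. -/
noncomputable def iterEmb (F : Type u) [Field F] : ∀ n : ℕ, F →+* IterLaurent F n
  | 0 => RingHom.id F
  | n + 1 =>
      ((HahnSeries.C : IterLaurent F n →+* LaurentSeries (IterLaurent F n)).comp
        (iterEmb F n) : F →+* LaurentSeries (IterLaurent F n))

/-- The variables `x₁, …, xₙ` of `F((x₁))…((xₙ))`: `xvar F n i` is the image of `x_{i+1}`. -/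
noncomputable def xvar (F : Type u) [Field F] : ∀ n : ℕ, Fin n → IterLaurent F n
  | 0 => Fin.elim0
  | n + 1 => fun i =>
      if h : (i : ℕ) < n then
        ((HahnSeries.C (xvar F n ⟨i, h⟩) : LaurentSeries (IterLaurent F n)) :
          LaurentSeries (IterLaurent F n))
      else
        (HahnSeries.single 1 1 : LaurentSeries (IterLaurent F n))

end QF

namespace QF

section Isometries

variable {R S : Type*} [CommRing R] [CommRing S] {m n k : ℕ}

/-- The bilinear form with `evalQF d` on the diagonal. -/
def bilQF (d v w : Fin n → R) : R := ∑ i, d i * v i * w i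

theorem evalQF_add (d v w : Fin n → R) :
    evalQF d (v + w) = evalQF d v + evalQF d w + 2 * bilQF d v w := by
  simp only [evalQF, bilQF, Finset.mul_sum, ← Finset.sum_add_distrib, Pi.add_apply]
  exact Finset.sum_congr rfl fun i _ => by ring

theorem evalQF_smul (d v : Fin n → R) (c : R) : evalQF d (c • v) = c ^ 2 * evalQF d v := by
  simp only [evalQF, Finset.mul_sum, Pi.smul_apply, smul_eq_mul]
  exact Finset.sum_congr rfl fun i _ => by ring

theorem evalQF_zero (d : Fin n → R) : evalQF d 0 = 0 := by simp [evalQF]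

theorem bilQF_smul_add_right (d u v w : Fin n → R) (c : R) :
    bilQF d u (c • v + w) = c * bilQF d u v + bilQF d u w := by
  simp only [bilQF, Finset.mul_sum, ← Finset.sum_add_distrib, Pi.add_apply, Pi.smul_apply,
    smul_eq_mul]
  exact Finset.sum_congr rfl fun i _ => by ring

theorem bilQF_smul_smul (d v w : Fin n → R) (a b : R) :
    bilQF d (a • v) (b • w) = a * b * bilQF d v w := by
  simp only [bilQF, Finset.mul_sum, Pi.smul_apply, smul_eq_mul]
  exact Finset.sum_congr rfl fun i _ => by ring

theorem evalQF_reflection {d e : Fin n → R}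
    (he : evalQF d e = 0) (y : Fin n → R) :
    evalQF d (evalQF d y • e + (-2 * bilQF d e y) • y) = 0 := by
  rw [evalQF_add, evalQF_smul, evalQF_smul, he, bilQF_smul_smul]
  ring

theorem bilQF_comm (d v w : Fin n → R) : bilQF d v w = bilQF d w v :=
  Finset.sum_congr rfl fun i _ => by ring

theorem bilQF_single (d w : Fin n → R) (i : Fin n) : bilQF d (Pi.single i 1) w = d i * w i := by
  rw [bilQF, Finset.sum_eq_single i] <;> simp +contextual

theorem bilQF_map (h2 : IsUnit (2 : R)) {d : Fin m → R} {e : Fin n → R}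
    (φ : (Fin m → R) →ₗ[R] (Fin n → R)) (h : ∀ v, evalQF e (φ v) = evalQF d v) (v w) :
    bilQF e (φ v) (φ w) = bilQF d v w := by
  have := h (v + w)
  rw [map_add, evalQF_add, evalQF_add, h, h] at this
  exact h2.mul_left_cancel (add_left_cancel this)

theorem evalQF_bc (f : R →+* S) (d v : Fin n → R) :
    evalQF (bc f d) (fun i => f (v i)) = f (evalQF d v) := by
  simp [evalQF, bc, map_sum]

theorem bc_osum (f : R →+* S) (d : Fin m → R) (e : Fin n → R) :
    bc f (osum d e) = osum (bc f d) (bc f e) := by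
  ext i
  refine Fin.addCases (fun i => ?_) (fun i => ?_) i <;> simp [bc, osum]

theorem bc_hypform (f : R →+* S) (k : ℕ) : bc f (hypform k) = hypform k := by
  ext i
  refine Fin.addCases (fun i => ?_) (fun i => ?_) i <;>
    simp only [bc, hypform, Fin.append_left, Fin.append_right, map_one, map_neg]

theorem Isometric.bc (h2 : IsUnit (2 : R)) (f : R →+* S) {d : Fin m → R} {e : Fin n → R}
    (h : Isometric d e) : Isometric (QF.bc f d) (QF.bc f e) := by
  obtain ⟨φ, hφ⟩ := h
  set M := LinearMap.toMatrix' φ.toLinearMap with hM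
  set N := LinearMap.toMatrix' φ.symm.toLinearMap with hN
  have hMN : M * N = 1 := by
    rw [hM, hN, ← LinearMap.toMatrix'_comp]; simp
  have hNM : N * M = 1 := by
    rw [hM, hN, ← LinearMap.toMatrix'_comp]; simp
  have gram : M.transpose * Matrix.diagonal e * M = Matrix.diagonal d := by
    ext i j
    have := bilQF_map h2 φ.toLinearMap hφ (Pi.single i 1) (Pi.single j 1)
    rw [bilQF_single] at this
    rw [Matrix.mul_apply, Matrix.diagonal_apply]
    simp only [Matrix.mul_diagonal, Matrix.transpose_apply, hM, LinearMap.toMatrix'_apply]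
    rw [bilQF] at this
    convert! this using 1
    · exact Finset.sum_congr rfl fun x _ => by simp [eq_comm]; ring
    · by_cases hij : i = j <;> simp [hij]
  have hval (v : Fin m → S) :
      evalQF (QF.bc f e) ((M.map f).mulVec v) = evalQF (QF.bc f d) v := by
    have key {a : ℕ} (c : Fin a → S) (w : Fin a → S) :
        evalQF c w = dotProduct w ((Matrix.diagonal c).mulVec w) := by
      simp only [evalQF, dotProduct, Matrix.mulVec_diagonal]
      exact Finset.sum_congr rfl fun i _ => by ring
    have gram' := congrArg (fun X => X.map f) gram
    simp only [Matrix.map_mul, Matrix.transpose_map, Matrix.diagonal_map (map_zero f)] at gram'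
    rw [key, key, show QF.bc f d = fun i => f (d i) from rfl, ← gram',
      ← Matrix.mulVec_mulVec, ← Matrix.mulVec_mulVec, Matrix.dotProduct_mulVec v,
      Matrix.vecMul_transpose]
    rfl
  refine ⟨Matrix.toLin'OfInv (M := N.map f) (M' := M.map f) ?_ ?_, fun v => ?_⟩
  · rw [← Matrix.map_mul, hNM]; simp
  · rw [← Matrix.map_mul, hMN]; simp
  · exact hval v

/-- The coordinates of a vector with respect to the summands of `osum (hypform k) r`. -/
def hypEquiv (R : Type*) [CommRing R] (k m : ℕ) :
    (Fin (k + k + m) → R) ≃ₗ[R] (Fin k → R) × (Fin k → R) × (Fin m → R) where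
  toFun v := (fun i => v (Fin.castAdd m (Fin.castAdd k i)),
    fun i => v (Fin.castAdd m (Fin.natAdd k i)), fun i => v (Fin.natAdd (k + k) i))
  invFun x := Fin.append (Fin.append x.1 x.2.1) x.2.2
  map_add' _ _ := rfl
  map_smul' _ _ := rfl
  left_inv v := by
    ext i
    refine Fin.addCases (fun i => ?_) (fun i => ?_) i
    · refine Fin.addCases (fun i => ?_) (fun i => ?_) i <;>
        simp only [Fin.append_left, Fin.append_right]
    · simp only [Fin.append_right]
  right_inv x := by simp only [Fin.append_left, Fin.append_right]

theorem evalQF_osum_hypform (r : Fin m → R) (v : Fin (k + k + m) → R) :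
    evalQF (osum (hypform k) r) v = ∑ i, (hypEquiv R k m v).1 i ^ 2
      - ∑ i, (hypEquiv R k m v).2.1 i ^ 2 + evalQF r (hypEquiv R k m v).2.2 := by
  simp only [evalQF, Fin.sum_univ_add, osum, hypform, hypEquiv, sub_eq_add_neg,
    Fin.append_left, Fin.append_right, ← Finset.sum_neg_distrib, one_mul, neg_mul,
    LinearEquiv.coe_mk, LinearMap.coe_mk, AddHom.coe_mk]

theorem isometric_osum_hypform_iff {d : Fin n → R} {r : Fin m → R} :
    Isometric d (osum (hypform k) r) ↔
      ∃ Φ : (Fin n → R) ≃ₗ[R] (Fin k → R) × (Fin k → R) × (Fin m → R), ∀ v,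
        evalQF d v = ∑ i, (Φ v).1 i ^ 2 - ∑ i, (Φ v).2.1 i ^ 2 + evalQF r (Φ v).2.2 := by
  constructor
  · rintro ⟨φ, hφ⟩
    exact ⟨φ.trans (hypEquiv R k m), fun v => by
      rw [← hφ, evalQF_osum_hypform]; rfl⟩
  · rintro ⟨Φ, hΦ⟩
    exact ⟨Φ.trans (hypEquiv R k m).symm, fun v => by
      rw [evalQF_osum_hypform, hΦ]; simp⟩

theorem finrank_of_isometric [Nontrivial R] {d : Fin n → R} {r : Fin m → R}
    (h : Isometric d (osum (hypform k) r)) : n = k + k + m := by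
  obtain ⟨φ, -⟩ := h
  simpa using φ.finrank_eq

theorem bddAbove_wittIndex [Nontrivial R] (d : Fin n → R) :
    BddAbove {k : ℕ | ∃ (m : ℕ) (r : Fin m → R), Isometric d (osum (hypform k) r)} :=
  ⟨n, fun k ⟨_, _, h⟩ => by have := finrank_of_isometric h; omega⟩

theorem le_wittIndex [Nontrivial R] {d : Fin n → R} {r : Fin m → R}
    (h : Isometric d (osum (hypform k) r)) : k ≤ WittIndex d :=
  le_csSup (bddAbove_wittIndex d) ⟨m, r, h⟩

theorem exists_isometric_wittIndex [Nontrivial R] (d : Fin n → R) :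
    ∃ (m : ℕ) (r : Fin m → R), Isometric d (osum (hypform (WittIndex d)) r) := by
  let Φ : (Fin n → R) ≃ₗ[R] (Fin 0 → R) × (Fin 0 → R) × (Fin n → R) :=
    { toFun := fun v => (0, 0, v)
      invFun := fun x => x.2.2
      map_add' := fun _ _ => by simp
      map_smul' := fun _ _ => by simp
      left_inv := fun _ => rfl
      right_inv := fun x => by ext i <;> first | exact i.elim0 | rfl }
  have h0 : Isometric d (osum (hypform 0) d) :=
    isometric_osum_hypform_iff.2 ⟨Φ, fun v => by simp [Φ]⟩
  have hne : {k : ℕ | ∃ (m : ℕ) (r : Fin m → R), Isometric d (osum (hypform k) r)}.Nonempty :=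
    ⟨0, n, d, h0⟩
  exact Nat.sSup_mem hne (bddAbove_wittIndex d)

theorem wittIndex_le_bc [Nontrivial R] [Nontrivial S] (h2 : IsUnit (2 : R)) (f : R →+* S)
    (d : Fin n → R) : WittIndex d ≤ WittIndex (bc f d) := by
  obtain ⟨m, r, h⟩ := exists_isometric_wittIndex d
  have := h.bc h2 f
  rw [bc_osum, bc_hypform] at this
  exact le_wittIndex this

theorem Isometric.nondeg [NoZeroDivisors R] [Nontrivial R] (h2 : IsUnit (2 : R)) {d : Fin m → R}
    {e : Fin n → R} (h : Isometric d e) (hd : Nondeg d) : Nondeg e := by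
  obtain ⟨φ, hφ⟩ := h
  intro i hi
  have h0 (w : Fin m → R) : bilQF d (φ.symm (Pi.single i 1)) w = 0 := by
    rw [← bilQF_map h2 φ.toLinearMap hφ]
    simp [bilQF_single, hi]
  have : φ.symm (Pi.single i 1) = 0 := by
    ext j
    have := h0 (Pi.single j 1)
    rw [bilQF_comm, bilQF_single] at this
    simpa [hd j] using this
  have h1 := congrFun (φ.symm.map_eq_zero_iff.1 this) i
  simp at h1

end Isometries

section Fields

variable {L : Type*} [Field L] {m n k : ℕ}

/-- `evalQF d` as a quadratic form. -/
def toQuadraticForm (d : Fin n → L) : QuadraticForm L (Fin n → L) :=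
  QuadraticMap.weightedSumSquares L d

theorem toQuadraticForm_apply (d v : Fin n → L) : toQuadraticForm d v = evalQF d v := by
  simp [toQuadraticForm, evalQF, QuadraticMap.weightedSumSquares_apply, sq]

/-- An isotropic nondegenerate form splits off a hyperbolic plane. -/
theorem exists_hyperbolic_plane (h2 : (2 : L) ≠ 0) {d : Fin n → L} (hd : Nondeg d)
    (hi : Isotropic d) : ∃ (m : ℕ) (r : Fin m → L) (Φ : (Fin n → L) ≃ₗ[L] L × L × (Fin m → L)),
      ∀ v, evalQF d v = (Φ v).1 ^ 2 - (Φ v).2.1 ^ 2 + evalQF r (Φ v).2.2 := by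
  obtain ⟨v, hv0, hv⟩ := hi
  obtain ⟨i, hi⟩ := Function.ne_iff.1 hv0
  set u : Fin n → L := Pi.single i 1 with hu
  have huv : bilQF d u v ≠ 0 := by rw [hu, bilQF_single]; exact mul_ne_zero (hd i) hi
  obtain ⟨e, he1, hev⟩ : ∃ e, evalQF d e = 1 ∧ bilQF d e v ≠ 0 := by
    refine ⟨((1 - evalQF d u) / (2 * bilQF d u v)) • v + u, ?_, ?_⟩
    · rw [add_comm, evalQF_add, evalQF_smul, hv, ← add_zero (_ • v), bilQF_smul_add_right]
      simp only [bilQF, Pi.zero_apply, mul_zero, Finset.sum_const_zero] at huv ⊢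
      field_simp
      ring
    · rw [bilQF_comm, bilQF_smul_add_right, bilQF_comm d v u]
      have : bilQF d v v = 0 := by
        rw [← hv]; exact Finset.sum_congr rfl fun i _ => by ring
      rwa [this, mul_zero, zero_add]
  have hdiag (w : Fin n → L) : bilQF d w w = evalQF d w :=
    Finset.sum_congr rfl fun i _ => by ring
  have add_l (x y z : Fin n → L) : bilQF d (x + y) z = bilQF d x z + bilQF d y z := by
    simp only [bilQF, ← Finset.sum_add_distrib, Pi.add_apply]
    exact Finset.sum_congr rfl fun i _ => by ring
  have smul_l (c : L) (x z : Fin n → L) : bilQF d (c • x) z = c * bilQF d x z := by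
    simp only [bilQF, Finset.mul_sum, Pi.smul_apply, smul_eq_mul]
    exact Finset.sum_congr rfl fun i _ => by ring
  let B : (Fin n → L) →ₗ[L] (Fin n → L) →ₗ[L] L := LinearMap.mk₂ L (bilQF d) add_l smul_l
    (fun x y z => by rw [bilQF_comm, add_l, bilQF_comm d y, bilQF_comm d z])
    (fun c x z => by rw [bilQF_comm, smul_l, bilQF_comm d z]; rfl)
  have hBs (x y) : B x y = B y x := bilQF_comm d x y
  have hBd (x) : B x x = evalQF d x := hdiag x
  set b := B e v with hb
  have hb0 : b ≠ 0 := hev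
  set f : Fin n → L := b⁻¹ • v - e with hf
  have hee : B e e = 1 := by rw [hBd, he1]
  have hef : B e f = 0 := by
    rw [hf, map_sub, map_smul, ← hb, smul_eq_mul, inv_mul_cancel₀ hb0, hee, sub_self]
  have hff : B f f = -1 := by
    have h1 : B f v = -b := by
      rw [hf, map_sub, LinearMap.sub_apply, map_smul, LinearMap.smul_apply, hBd, hv, ← hb]
      simp
    have : B f f = b⁻¹ * B f v - B f e := by
      conv_lhs => rw [hf]
      rw [map_sub (B (b⁻¹ • v - e)), map_smul (B (b⁻¹ • v - e)), ← hf, smul_eq_mul]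
    rw [this, h1, hBs f e, hef]
    field_simp
    simp
  have hfe : B f e = 0 := by rw [hBs, hef]
  let V := LinearMap.ker (B e) ⊓ LinearMap.ker (B f)
  have hV (x : Fin n → L) : x - B e x • e + B f x • f ∈ V := by
    simp [V, hee, hef, hff, hfe]
  let Ψ : (Fin n → L) ≃ₗ[L] L × L × V :=
    { toFun := fun x => (B e x, B f x, ⟨_, hV x⟩)
      invFun := fun y => y.1 • e - y.2.1 • f + y.2.2
      map_add' := fun x y => by
        refine Prod.ext (by simp) (Prod.ext (by simp) (Subtype.ext ?_))
        simp only [map_add, Prod.snd_add, Submodule.coe_add, add_smul]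
        abel
      map_smul' := fun c x => by
        refine Prod.ext (by simp) (Prod.ext (by simp) (Subtype.ext ?_))
        simp [smul_sub, smul_add, mul_smul]
      left_inv := fun x => by simp
      right_inv := fun ⟨x, y, z, hz⟩ => by
        have hz1 : B e z = 0 := hz.1
        have hz2 : B f z = 0 := hz.2
        refine Prod.ext ?_ (Prod.ext ?_ (Subtype.ext ?_))
        · simp [hee, hef, hz1]
        · simp [hff, hfe, hz2]
        · simp [hee, hef, hff, hfe, hz1, hz2]
          abel }
  have : Invertible (2 : L) := invertibleOfNonzero h2
  obtain ⟨r, ⟨θ⟩⟩ := QuadraticForm.equivalent_weightedSumSquares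
    ((toQuadraticForm d).comp V.subtype)
  refine ⟨_, r, Ψ.trans (LinearEquiv.prodCongr (.refl L L) (LinearEquiv.prodCongr (.refl L L)
    θ.toLinearEquiv)), fun w => ?_⟩
  have hθ := θ.map_app (Ψ w).2.2
  change toQuadraticForm r _ = toQuadraticForm d _ at hθ
  rw [toQuadraticForm_apply, toQuadraticForm_apply] at hθ
  have e1 : evalQF d w = (Ψ w).1 ^ 2 - (Ψ w).2.1 ^ 2 + evalQF d (Ψ w).2.2 := by
    rw [← hBd, ← hBd]
    change B w w = B e w ^ 2 - B f w ^ 2 +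
      B (w - B e w • e + B f w • f) (w - B e w • e + B f w • f)
    simp only [map_add, map_sub, map_smul, LinearMap.add_apply, LinearMap.sub_apply,
      LinearMap.smul_apply, smul_eq_mul, hee, hef, hfe, hff, hBs w e, hBs w f]
    ring
  rw [e1]
  congr 1
  exact hθ.symm

theorem exists_isometric_anisotropic (h2 : (2 : L) ≠ 0) {d : Fin n → L} (hd : Nondeg d) :
    ∃ (m : ℕ) (r : Fin m → L), Isometric d (osum (hypform (WittIndex d)) r) ∧
      Anisotropic r := by
  obtain ⟨m, r, h⟩ := exists_isometric_wittIndex d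
  have hr : Nondeg r := fun i => by
    have := h.nondeg (isUnit_iff_ne_zero.2 h2) hd (Fin.natAdd _ i)
    rwa [osum, Fin.append_right] at this
  refine ⟨m, r, h, fun hi => ?_⟩
  obtain ⟨m', r', Ψ, hΨ⟩ := exists_hyperbolic_plane h2 hr hi
  have hmax {k m : ℕ} {r : Fin m → L} (h : Isometric d (osum (hypform k) r)) := le_wittIndex h
  generalize WittIndex d = k at h hmax
  obtain ⟨Φ, hΦ⟩ := isometric_osum_hypform_iff.1 h
  let T : ((Fin k → L) × (Fin k → L) × (L × L × (Fin m' → L))) ≃ₗ[L]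
      ((Fin (k + 1) → L) × (Fin (k + 1) → L) × (Fin m' → L)) :=
    { toFun := fun x => (Fin.cons x.2.2.1 x.1, Fin.cons x.2.2.2.1 x.2.1, x.2.2.2.2)
      invFun := fun y => (Fin.tail y.1, Fin.tail y.2.1, y.1 0, y.2.1 0, y.2.2)
      map_add' := fun x y => by
        refine Prod.ext ?_ (Prod.ext ?_ rfl) <;> ext i <;> refine Fin.cases ?_ (fun i => ?_) i <;>
          simp
      map_smul' := fun c x => by
        refine Prod.ext ?_ (Prod.ext ?_ rfl) <;> ext i <;> refine Fin.cases ?_ (fun i => ?_) i <;>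
          simp
      left_inv := fun x => by simp
      right_inv := fun y => by simp }
  have : Isometric d (osum (hypform (k + 1)) r') := by
    refine isometric_osum_hypform_iff.2 ⟨Φ.trans ((LinearEquiv.prodCongr (.refl L _)
      (LinearEquiv.prodCongr (.refl L _) Ψ)).trans T), fun v => ?_⟩
    rw [hΦ, hΨ]
    simp [T, Fin.sum_univ_succ]
    ring
  have := hmax this
  omega

/-- A totally isotropic space for `∑ sᵢ aᵢ bᵢ + R(z)` with `R` anisotropic has dimension at most
the number of hyperbolic planes. -/
theorem finrank_le_of_totally_isotropic {κ μ W : Type*} [Fintype κ] [Fintype μ]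
    [AddCommGroup W] [Module L W]
    [FiniteDimensional L W] {s : κ → L} (hs : ∀ i, s i ≠ 0) {r : μ → L}
    (hr : ∀ z : μ → L, ∑ i, r i * z i ^ 2 = 0 → z = 0)
    (a b : W →ₗ[L] κ → L) (z : W →ₗ[L] μ → L)
    (hinj : ∀ w, a w = 0 → b w = 0 → z w = 0 → w = 0)
    (h0 : ∀ w, ∑ i, s i * a w i * b w i + ∑ i, r i * z w i ^ 2 = 0) :
    Module.finrank L W ≤ Fintype.card κ := by
  let K := LinearMap.ker a
  have hz (w : K) : z w = 0 := hr _ (by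
    have := h0 w
    rwa [show a w = 0 from w.2, show (∑ i, s i * (0 : κ → L) i * b w i) = 0 by simp,
      zero_add] at this)
  have hpair (w : W) (w' : K) : ∑ i, s i * a w i * b w' i = 0 := by
    have h1 := h0 (w + w')
    have h3 := h0 w
    rw [map_add, map_add, map_add, show a w' = 0 from w'.2, hz w', add_zero, add_zero] at h1
    simp only [Pi.add_apply, mul_add, Finset.sum_add_distrib] at h1
    linear_combination h1 - h3
  let P : (κ → L) →ₗ[L] Module.Dual L (κ → L) :=
    LinearMap.mk₂ L (fun x y => ∑ i, s i * x i * y i) (fun x x' y => by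
        simp [mul_add, add_mul, Finset.sum_add_distrib]) (fun c x y => by
          simp only [Pi.smul_apply, smul_eq_mul, Finset.mul_sum]
          exact Finset.sum_congr rfl fun i _ => by ring) (fun x x' y => by
        simp [mul_add, Finset.sum_add_distrib]) (fun c x y => by
          simp only [Pi.smul_apply, smul_eq_mul, Finset.mul_sum]
          exact Finset.sum_congr rfl fun i _ => by ring)
  have hP : Function.Injective P := by
    rw [← LinearMap.ker_eq_bot, LinearMap.ker_eq_bot']
    intro x hx
    ext i
    have := congrArg (fun g => g (Pi.single i 1)) hx
    simpa [P, Finset.sum_eq_single i, Pi.single_apply, hs i] using this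
  let ψ : K →ₗ[L] (LinearMap.range a).dualAnnihilator :=
    (P.comp (b.comp K.subtype)).codRestrict _ (fun w' => by
      rw [Submodule.mem_dualAnnihilator]
      rintro _ ⟨w, rfl⟩
      rw [← hpair w w']
      exact Finset.sum_congr rfl fun i _ => by simp; ring)
  have hψ : Function.Injective ψ := by
    refine (injective_iff_map_eq_zero ψ).2 fun w hw => ?_
    have : P (b w) = 0 := congrArg Subtype.val hw
    exact Subtype.ext (hinj w w.2 ((map_eq_zero_iff P hP).1 this) (hz w))
  have h1 := LinearMap.finrank_le_finrank_of_injective hψ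
  have h3 := Subspace.finrank_add_finrank_dualAnnihilator_eq (LinearMap.range a)
  have h4 := LinearMap.finrank_range_add_finrank_ker a
  rw [Module.finrank_fintype_fun_eq_card] at h3
  change Module.finrank L K ≤ _ at h1
  change _ + Module.finrank L K = _ at h4
  omega

end Fields

section TotallyIsotropic

variable {L : Type*} [Field L] {m n k : ℕ}

theorem Isometric.finrank_le (h2 : (2 : L) ≠ 0) {d : Fin n → L} {r : Fin m → L}
    (h : Isometric d (osum (hypform k) r)) (hr : Anisotropic r) {W : Type*}
    [AddCommGroup W] [Module L W] [FiniteDimensional L W] (g : W →ₗ[L] Fin n → L)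
    (hg : Function.Injective g) (h0 : ∀ w, evalQF d (g w) = 0) :
    Module.finrank L W ≤ k := by
  obtain ⟨Φ, hΦ⟩ := isometric_osum_hypform_iff.1 h
  let A := LinearMap.fst L _ _ ∘ₗ Φ.toLinearMap ∘ₗ g
  let B := LinearMap.fst L _ _ ∘ₗ LinearMap.snd L _ _ ∘ₗ Φ.toLinearMap ∘ₗ g
  let Z := LinearMap.snd L _ _ ∘ₗ LinearMap.snd L _ _ ∘ₗ Φ.toLinearMap ∘ₗ g
  have := finrank_le_of_totally_isotropic (s := fun _ => 1) (fun _ => one_ne_zero) (r := r)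
    (fun z hz => by_contra fun hz0 => hr ⟨z, hz0, hz⟩) (A - B) (A + B) Z
    (fun w h1 h3 h4 => by
      have hA : A w = 0 := by
        have : (2 : L) • A w = 0 := by
          rw [two_smul, ← add_zero (0 : Fin _ → L)]
          nth_rw 2 [← h1]
          rw [← h3]
          simp
        exact (smul_eq_zero.1 this).resolve_left h2
      have hB : B w = 0 := by simpa [hA] using h3
      have : Φ (g w) = 0 := Prod.ext hA (Prod.ext hB h4)
      exact hg (by rw [Φ.map_eq_zero_iff.1 this, map_zero]))
    (fun w => by
      rw [← h0 w, hΦ]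
      congr 1
      rw [← Finset.sum_sub_distrib]
      exact Finset.sum_congr rfl fun i _ => by simp [A, B]; ring)
  simpa using this

theorem finrank_le_wittIndex (h2 : (2 : L) ≠ 0) {d : Fin n → L} (hd : Nondeg d) {W : Type*}
    [AddCommGroup W] [Module L W] [FiniteDimensional L W] (g : W →ₗ[L] Fin n → L)
    (hg : Function.Injective g) (h0 : ∀ w, evalQF d (g w) = 0) :
    Module.finrank L W ≤ WittIndex d := by
  obtain ⟨m, r, h, hr⟩ := exists_isometric_anisotropic h2 hd
  exact h.finrank_le h2 hr g hg h0

theorem exists_totally_isotropic (d : Fin n → L) :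
    ∃ g : (Fin (WittIndex d) → L) →ₗ[L] Fin n → L, Function.Injective g ∧
      ∀ w, evalQF d (g w) = 0 := by
  obtain ⟨m, r, h⟩ := exists_isometric_wittIndex d
  obtain ⟨Φ, hΦ⟩ := isometric_osum_hypform_iff.1 h
  refine ⟨Φ.symm.toLinearMap ∘ₗ LinearMap.prod .id (LinearMap.prod .id 0), ?_, fun w => ?_⟩
  · refine Φ.symm.injective.comp fun x y hxy => congrArg Prod.fst hxy
  · rw [hΦ]
    simp [evalQF_zero]

end TotallyIsotropic

section Double

variable {R S : Type*} [CommRing R] [CommRing S] {m n : ℕ}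

/-- `Q` is the form `⟨1, -t⟩ ⊗ q`, up to a permutation of the coefficients. -/
def IsDouble (t : R) (q : Fin n → R) (Q : Fin m → R) : Prop :=
  ∃ σ : Fin n ⊕ Fin n ≃ Fin m,
    (∀ i, Q (σ (.inl i)) = q i) ∧ ∀ i, Q (σ (.inr i)) = -t * q i

theorem IsDouble.bc (f : R →+* S) {t : R} {q : Fin n → R} {Q : Fin m → R} (h : IsDouble t q Q) :
    IsDouble (f t) (QF.bc f q) (QF.bc f Q) := by
  obtain ⟨σ, h1, h2⟩ := h
  exact ⟨σ, fun i => by simp [QF.bc, h1], fun i => by simp [QF.bc, h2]⟩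

theorem IsDouble.nondeg [NoZeroDivisors R] {t : R} (ht : t ≠ 0) {q : Fin n → R} {Q : Fin m → R}
    (h : IsDouble t q Q) (hq : Nondeg q) : Nondeg Q := by
  obtain ⟨σ, h1, h2⟩ := h
  intro i
  obtain ⟨j, rfl⟩ := σ.surjective i
  rcases j with j | j
  · rw [h1]; exact hq j
  · rw [h2]; exact mul_ne_zero (neg_ne_zero.2 ht) (hq j)

theorem IsDouble.card {t : R} {q : Fin n → R} {Q : Fin m → R} (h : IsDouble t q Q) :
    m = n + n := by
  obtain ⟨σ, -⟩ := h
  simpa using (Fintype.card_congr σ).symm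

theorem IsDouble.exists_equiv {t : R} {q : Fin n → R} {Q : Fin m → R} (h : IsDouble t q Q) :
    ∃ Ψ : (Fin m → R) ≃ₗ[R] (Fin n → R) × (Fin n → R), ∀ v,
      evalQF Q v = evalQF q (Ψ v).1 - t * evalQF q (Ψ v).2 := by
  obtain ⟨σ, h1, h2⟩ := h
  refine ⟨(LinearEquiv.funCongrLeft R R σ).trans (LinearEquiv.sumArrowLequivProdArrow _ _ R R),
    fun v => ?_⟩
  rw [evalQF, ← σ.sum_comp, Fintype.sum_sum_type]
  simp only [h1, h2, evalQF, Finset.mul_sum, sub_eq_add_neg, ← Finset.sum_neg_distrib]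
  congr 1
  exact Finset.sum_congr rfl fun i _ => by
    simp [LinearEquiv.funCongrLeft_apply, LinearMap.funLeft]; ring

variable {L : Type*} [Field L]

theorem IsDouble.finrank_le_wittIndex (h2 : (2 : L) ≠ 0) {t : L} (ht : t ≠ 0) {q : Fin n → L}
    {Q : Fin m → L} (h : IsDouble t q Q) (hq : Nondeg q) {W : Type*} [AddCommGroup W] [Module L W]
    [FiniteDimensional L W] (g : W →ₗ[L] (Fin n → L) × (Fin n → L)) (hg : Function.Injective g)
    (h0 : ∀ w, evalQF q (g w).1 = t * evalQF q (g w).2) :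
    Module.finrank L W ≤ WittIndex Q := by
  obtain ⟨Ψ, hΨ⟩ := h.exists_equiv
  exact QF.finrank_le_wittIndex h2 (h.nondeg ht hq) (Ψ.symm.toLinearMap ∘ₗ g)
    (Ψ.symm.injective.comp hg) fun w => by rw [hΨ]; simp [h0]

theorem IsDouble.two_mul_wittIndex_le (h2 : (2 : L) ≠ 0) {t : L} (ht : t ≠ 0) {q : Fin n → L}
    {Q : Fin m → L} (h : IsDouble t q Q) (hq : Nondeg q) : 2 * WittIndex q ≤ WittIndex Q := by
  obtain ⟨g, hg, h0⟩ := exists_totally_isotropic q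
  have := h.finrank_le_wittIndex h2 ht hq (g.prodMap g) (hg.prodMap hg) fun w => by
    simp [h0]
  rw [Module.finrank_prod, Module.finrank_fin_fun] at this
  omega

end Double

section Springer

variable {F : Type*} [Field F] {m n : ℕ}

theorem order_evalQF_laurent {r : Fin n → F} (hr : Anisotropic r) {v : Fin n → LaurentSeries F}
    (hv : v ≠ 0) : evalQF (bc (HahnSeries.C : F →+* LaurentSeries F) r) v ≠ 0 ∧
      ∃ N : ℤ, (evalQF (bc (HahnSeries.C : F →+* LaurentSeries F) r) v).order = N + N := by
  obtain ⟨i₀, hi₀⟩ := Function.ne_iff.1 hv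
  obtain ⟨i, hi, hmin⟩ := Finset.exists_min_image (Finset.univ.filter fun i => v i ≠ 0)
    (fun i => (v i).order) ⟨i₀, by simpa using hi₀⟩
  set N := (v i).order with hN
  have hi0 : v i ≠ 0 := by simpa using hi
  have hmin' (j) (hj : v j ≠ 0) : N ≤ (v j).order := hmin j (by simpa using hj)
  have hlow (j : Fin n) (a : ℤ) (ha : a < N + N) : (v j ^ 2).coeff a = 0 := by
    by_cases hj : v j = 0
    · simp [hj]
    · apply HahnSeries.coeff_eq_zero_of_lt_order
      rw [sq, HahnSeries.order_mul hj hj]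
      have := hmin' j hj
      omega
  have hN2 (j : Fin n) : (v j ^ 2).coeff (N + N) = (v j).coeff N ^ 2 := by
    by_cases hj : v j = 0
    · simp [hj]
    rcases (hmin' j hj).eq_or_lt with h | h
    · rw [sq, sq, h, HahnSeries.coeff_mul_order_add_order, HahnSeries.leadingCoeff_eq]
    · rw [HahnSeries.coeff_eq_zero_of_lt_order h, HahnSeries.coeff_eq_zero_of_lt_order,
        zero_pow two_ne_zero]
      rw [sq, HahnSeries.order_mul hj hj]
      omega
  have hcoeff (a : ℤ) : (evalQF (bc (HahnSeries.C : F →+* LaurentSeries F) r) v).coeff a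
      = ∑ j, r j * (v j ^ 2).coeff a := by
    simp [evalQF, bc, HahnSeries.coeff_sum]
  have htop : (evalQF (bc (HahnSeries.C : F →+* LaurentSeries F) r) v).coeff (N + N) ≠ 0 := by
    rw [hcoeff]
    simp only [hN2]
    intro h0
    refine hr ⟨fun j => (v j).coeff N, fun h => ?_, h0⟩
    exact hi0 (HahnSeries.coeff_order_eq_zero.1 (congrFun h i))
  have hne : evalQF (bc (HahnSeries.C : F →+* LaurentSeries F) r) v ≠ 0 := by
    intro h
    simp [h] at htop
  refine ⟨hne, N, le_antisymm (HahnSeries.order_le_of_coeff_ne_zero htop) (not_lt.1 fun h => ?_)⟩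
  refine hne (HahnSeries.coeff_order_eq_zero.1 ?_)
  rw [hcoeff]
  exact Finset.sum_eq_zero fun j _ => by rw [hlow j _ h, mul_zero]

theorem eq_zero_of_evalQF_laurent {r : Fin n → F} (hr : Anisotropic r)
    {u v : Fin n → LaurentSeries F}
    (h : evalQF (bc (HahnSeries.C : F →+* LaurentSeries F) r) u =
      HahnSeries.single 1 1 * evalQF (bc (HahnSeries.C : F →+* LaurentSeries F) r) v) :
    u = 0 ∧ v = 0 := by
  have hx : (HahnSeries.single 1 1 : LaurentSeries F) ≠ 0 := by simp
  by_cases hu : u = 0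
  · refine ⟨hu, by_contra fun hv => ?_⟩
    rw [hu, evalQF_zero] at h
    exact mul_ne_zero hx (order_evalQF_laurent hr hv).1 h.symm
  by_cases hv : v = 0
  · rw [hv, evalQF_zero, mul_zero] at h
    exact absurd h (order_evalQF_laurent hr hu).1
  obtain ⟨-, N, hN⟩ := order_evalQF_laurent hr hu
  obtain ⟨h0, M, hM⟩ := order_evalQF_laurent hr hv
  rw [h, HahnSeries.order_mul hx h0, hM, HahnSeries.order_single one_ne_zero] at hN
  omega

theorem anisotropic_double_laurent {r : Fin n → F} (hr : Anisotropic r)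
    {P : Fin m → LaurentSeries F}
    (hP : IsDouble (HahnSeries.single 1 1) (bc (HahnSeries.C : F →+* LaurentSeries F) r) P) :
    Anisotropic P := by
  rintro ⟨v, hv, h0⟩
  obtain ⟨Ψ, hΨ⟩ := hP.exists_equiv
  obtain ⟨h1, h2⟩ := eq_zero_of_evalQF_laurent hr (sub_eq_zero.1 ((hΨ v).symm.trans h0))
  exact hv (Ψ.map_eq_zero_iff.1 (Prod.ext h1 h2))

theorem wittIndex_double_laurent (h2 : (2 : F) ≠ 0) {q : Fin n → F} (hq : Nondeg q)
    {Q : Fin m → LaurentSeries F}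
    (hQ : IsDouble (HahnSeries.single 1 1) (bc (HahnSeries.C : F →+* LaurentSeries F) q) Q) :
    WittIndex Q = 2 * WittIndex q := by
  let c : F →+* LaurentSeries F := HahnSeries.C
  set x : LaurentSeries F := HahnSeries.single 1 1 with hxdef
  have hx : x ≠ 0 := by simp [x]
  have h2F := isUnit_iff_ne_zero.2 h2
  have h2' : (2 : LaurentSeries F) ≠ 0 := by
    rw [← map_ofNat c 2]; exact (map_ne_zero c).2 h2
  have hq' : Nondeg (bc c q) := fun i => (map_ne_zero c).2 (hq i)
  apply le_antisymm
  · obtain ⟨l, r, h, hr⟩ := exists_isometric_anisotropic h2 hq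
    have h' := h.bc h2F c
    rw [bc_osum, bc_hypform] at h'
    obtain ⟨Φ, hΦ⟩ := isometric_osum_hypform_iff.1 h'
    generalize WittIndex q = k at *
    obtain ⟨g, hg, h0⟩ := exists_totally_isotropic Q
    obtain ⟨Ψ, hΨ⟩ := hQ.exists_equiv
    let f₁ := Φ.toLinearMap ∘ₗ LinearMap.fst _ _ _ ∘ₗ Ψ.toLinearMap ∘ₗ g
    let f₂ := Φ.toLinearMap ∘ₗ LinearMap.snd _ _ _ ∘ₗ Ψ.toLinearMap ∘ₗ g
    let δ : (Fin k → LaurentSeries F) × (Fin k → LaurentSeries F) ×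
      (Fin l → LaurentSeries F) →ₗ[LaurentSeries F] (Fin k → LaurentSeries F) :=
        LinearMap.fst _ _ _ - LinearMap.fst _ _ _ ∘ₗ LinearMap.snd _ _ _
    let ε : (Fin k → LaurentSeries F) × (Fin k → LaurentSeries F) ×
      (Fin l → LaurentSeries F) →ₗ[LaurentSeries F] (Fin k → LaurentSeries F) :=
        LinearMap.fst _ _ _ + LinearMap.fst _ _ _ ∘ₗ LinearMap.snd _ _ _
    let ζ : (Fin k → LaurentSeries F) × (Fin k → LaurentSeries F) ×
      (Fin l → LaurentSeries F) →ₗ[LaurentSeries F] (Fin l → LaurentSeries F) :=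
        LinearMap.snd _ _ _ ∘ₗ LinearMap.snd _ _ _
    have hinj (y) (h1 : δ y = 0) (h3 : ε y = 0) (h4 : ζ y = 0) : y = 0 := by
      have h1' : y.1 - y.2.1 = 0 := h1
      have h3' : y.1 + y.2.1 = 0 := h3
      have hA : y.1 = 0 := by
        have : (2 : LaurentSeries F) • y.1 = 0 := by
          rw [two_smul]
          calc y.1 + y.1 = (y.1 - y.2.1) + (y.1 + y.2.1) := by abel
            _ = 0 := by rw [h1', h3', add_zero]
        exact (smul_eq_zero.1 this).resolve_left h2'
      exact Prod.ext hA (Prod.ext (by simpa [hA] using h3') h4)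
    have hval (y) : ∑ i, y.1 i ^ 2 - ∑ i, y.2.1 i ^ 2 + evalQF (bc c r) y.2.2 =
        ∑ i, δ y i * ε y i + evalQF (bc c r) (ζ y) := by
      rw [← Finset.sum_sub_distrib]
      congr 1
      exact Finset.sum_congr rfl fun i _ => by simp [δ, ε]; ring
    let E (a : ℕ) := (LinearEquiv.sumArrowLequivProdArrow (Fin a) (Fin a) (LaurentSeries F)
      (LaurentSeries F)).symm.toLinearMap
    have hE (a : ℕ) (y) (hy : E a y = 0) : y.1 = 0 ∧ y.2 = 0 := by
      have := (LinearEquiv.map_eq_zero_iff _).1 hy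
      simp [this]
    have := finrank_le_of_totally_isotropic
      (s := (Sum.elim (fun _ => 1) (fun _ => -x) : Fin k ⊕ Fin k → LaurentSeries F))
      (by rintro (i | i) <;> simp [hx])
      (r := (Sum.elim (bc c r) (fun i => -x * bc c r i) : Fin l ⊕ Fin l → LaurentSeries F))
      (fun z hz => by
        have := eq_zero_of_evalQF_laurent hr (u := z ∘ .inl) (v := z ∘ .inr) (by
          rw [← sub_eq_zero, ← hz, Fintype.sum_sum_type]
          simp [evalQF, Finset.mul_sum, c, x, sub_eq_add_neg, mul_assoc])
        ext1 (i | i)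
        · exact congrFun this.1 i
        · exact congrFun this.2 i)
      (E k ∘ₗ (δ ∘ₗ f₁).prod (δ ∘ₗ f₂)) (E k ∘ₗ (ε ∘ₗ f₁).prod (ε ∘ₗ f₂))
      (E l ∘ₗ (ζ ∘ₗ f₁).prod (ζ ∘ₗ f₂))
      (fun w h1 h3 h4 => by
        have e1 := hE _ _ h1
        have e3 := hE _ _ h3
        have e4 := hE _ _ h4
        have i1 := hinj _ e1.1 e3.1 e4.1
        have i2 := hinj _ e1.2 e3.2 e4.2
        have : Ψ (g w) = 0 := Prod.ext (Φ.map_eq_zero_iff.1 i1) (Φ.map_eq_zero_iff.1 i2)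
        exact hg (by rw [Ψ.map_eq_zero_iff.1 this, map_zero]))
      (fun w => by
        rw [← h0 w, hΨ, hΦ, hΦ, hval, hval]
        simp [E, Fintype.sum_sum_type, evalQF, Finset.mul_sum, mul_add, mul_assoc, f₁, f₂]
        ring)
    rw [Module.finrank_fin_fun] at this
    simpa [two_mul] using this
  · exact (Nat.mul_le_mul_left 2 (wittIndex_le_bc h2F c q)).trans
      (hQ.two_mul_wittIndex_le h2' hx hq')

end Springer

section Polynomial

variable {F : Type*} [Field F] {n N : ℕ}

theorem eq_zero_of_evalQF_mvPolynomial {r : Fin n → F} (hr : Anisotropic r)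
    {v : Fin n → MvPolynomial (Fin N) F}
    (h : evalQF (bc (MvPolynomial.C : F →+* MvPolynomial (Fin N) F) r) v = 0) : v = 0 := by
  by_contra hv
  obtain ⟨i₀, hi₀⟩ := Function.ne_iff.1 hv
  let o : MonomialOrder (Fin N) := MonomialOrder.lex
  obtain ⟨i, hi, hmax⟩ := Finset.exists_max_image (Finset.univ.filter fun i => v i ≠ 0)
    (fun i => o.toSyn (o.degree (v i))) ⟨i₀, by simpa using hi₀⟩
  have hi0 : v i ≠ 0 := by simpa using hi
  set D := o.degree (v i) with hD
  have hmax' (j : Fin n) : o.toSyn (o.degree (v j)) ≤ o.toSyn D := by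
    by_cases hj : v j = 0
    · rw [hj, o.degree_zero, map_zero]; exact o.zero_le _
    · exact hmax j (by simpa using hj)
  refine hr ⟨fun j => (v j).coeff D, fun h0 => hi0 ?_, ?_⟩
  · exact o.leadingCoeff_eq_zero_iff.1 (congrFun h0 i)
  · have := congrArg (MvPolynomial.coeff (D + D)) h
    simpa [evalQF, bc, MvPolynomial.coeff_sum, MvPolynomial.coeff_C_mul, sq,
      o.coeff_mul_of_add_of_degree_le (hmax' _) (hmax' _)] using this

theorem anisotropic_fractionRing_mvPolynomial {r : Fin n → F} (hr : Anisotropic r) :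
    Anisotropic (bc (algebraMap F (FractionRing (MvPolynomial (Fin N) F))) r) := by
  rintro ⟨v, hv, h⟩
  obtain ⟨b, hb⟩ := IsLocalization.exist_integer_multiples_of_finite
    (nonZeroDivisors (MvPolynomial (Fin N) F)) v
  choose w hw using hb
  have hb0 :
      algebraMap _ (FractionRing (MvPolynomial (Fin N) F)) (b : MvPolynomial (Fin N) F) ≠ 0 :=
    IsFractionRing.to_map_ne_zero_of_mem_nonZeroDivisors b.2
  have hw' (i) : algebraMap _ (FractionRing (MvPolynomial (Fin N) F)) (w i) =
      algebraMap _ (FractionRing (MvPolynomial (Fin N) F)) (b : MvPolynomial (Fin N) F) * v i := by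
    rw [hw, Algebra.smul_def]
  have hw0 : w = 0 := by
    refine eq_zero_of_evalQF_mvPolynomial hr (IsFractionRing.injective _
      (FractionRing (MvPolynomial (Fin N) F)) ?_)
    rw [← evalQF_bc, map_zero]
    simp only [hw']
    have := evalQF_smul (bc (algebraMap F (FractionRing (MvPolynomial (Fin N) F))) r) v
      (algebraMap _ (FractionRing (MvPolynomial (Fin N) F)) (b : MvPolynomial (Fin N) F))
    rw [h, mul_zero] at this
    exact this
  refine hv (funext fun i => ?_)
  have := hw' i
  rw [hw0, Pi.zero_apply, map_zero] at this
  exact (mul_eq_zero.1 this.symm).resolve_left hb0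

theorem wittIndex_fractionRing_mvPolynomial_le (h2 : (2 : F) ≠ 0) {q : Fin n → F} (hq : Nondeg q) :
    WittIndex (bc (algebraMap F (FractionRing (MvPolynomial (Fin N) F))) q) ≤ WittIndex q := by
  let f := algebraMap F (FractionRing (MvPolynomial (Fin N) F))
  obtain ⟨m, r, h, hr⟩ := exists_isometric_anisotropic h2 hq
  have h' := h.bc (isUnit_iff_ne_zero.2 h2) f
  rw [bc_osum, bc_hypform] at h'
  obtain ⟨g, hg, h0⟩ := exists_totally_isotropic (bc f q)
  have h2' : (2 : FractionRing (MvPolynomial (Fin N) F)) ≠ 0 := by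
    rw [← map_ofNat f 2]
    exact (map_ne_zero f).2 h2
  simpa using h'.finrank_le h2' (anisotropic_fractionRing_mvPolynomial hr) g hg h0

end Polynomial

section Quadric

universe v

variable {F : Type*} {E : Type v} [Field F] [Field E] {m : ℕ}

theorem eval₂Hom_formPoly {S : Type*} [CommRing S] {n : ℕ} (f : F →+* S) (p : Fin n → F)
    (x : Fin n → S) : MvPolynomial.eval₂Hom f x (formPoly p) = evalQF (bc f p) x := by
  simp [formPoly, evalQF, bc]

theorem eval₂Hom_rename_succ {S : Type*} [CommRing S] (f : F →+* S) (x : Fin (m + 1) → S)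
    (α : MvPolynomial (Fin m) F) :
    MvPolynomial.eval₂Hom f x (MvPolynomial.rename Fin.succ α) =
      MvPolynomial.eval₂Hom f (fun i => x i.succ) α := by
  simp [MvPolynomial.eval₂_rename, Function.comp_def]

theorem formPoly_succ (p : Fin (m + 1) → F) :
    formPoly p = MvPolynomial.C (p 0) * MvPolynomial.X 0 ^ 2 +
      MvPolynomial.rename Fin.succ (formPoly fun i => p i.succ) := by
  simp [formPoly, Fin.sum_univ_succ]

/-- Modulo the equation of a quadric, every polynomial is linear in the first variable. -/
theorem exists_linear_mod_formPoly (p : Fin (m + 1) → F) (hp : p 0 ≠ 0)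
    (g : MvPolynomial (Fin (m + 1)) F) :
    ∃ α β : MvPolynomial (Fin m) F, formPoly p ∣ g - (MvPolynomial.rename Fin.succ α +
      MvPolynomial.rename Fin.succ β * MvPolynomial.X 0) := by
  induction g using MvPolynomial.induction_on with
  | C c => exact ⟨MvPolynomial.C c, 0, by simp⟩
  | add g h hg hh =>
    obtain ⟨α, β, h1⟩ := hg
    obtain ⟨γ, δ, h2⟩ := hh
    refine ⟨α + γ, β + δ, ?_⟩
    convert dvd_add h1 h2 using 1
    simp only [map_add]
    ring
  | mul_X g i hg =>
    obtain ⟨α, β, h1⟩ := hg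
    refine Fin.cases ?_ (fun i => ?_) i
    · refine ⟨-(MvPolynomial.C (p 0)⁻¹ * β * formPoly fun i => p i.succ), α, ?_⟩
      have hc : (MvPolynomial.C (p 0)⁻¹ * MvPolynomial.C (p 0) : MvPolynomial (Fin (m + 1)) F)
          = 1 := by
        rw [← MvPolynomial.C_mul, inv_mul_cancel₀ hp, MvPolynomial.C_1]
      convert dvd_add (h1.mul_right (MvPolynomial.X 0)) (dvd_mul_left (formPoly p)
        (MvPolynomial.C (p 0)⁻¹ * MvPolynomial.rename Fin.succ β)) using 1
      rw [formPoly_succ]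
      simp only [map_neg, map_mul, MvPolynomial.rename_C]
      linear_combination (-MvPolynomial.rename Fin.succ β * MvPolynomial.X 0 ^ 2) * hc
    · refine ⟨α * MvPolynomial.X i, β * MvPolynomial.X i, ?_⟩
      convert h1.mul_right (MvPolynomial.X i.succ) using 1
      simp only [map_mul, MvPolynomial.rename_X]
      ring

/-- The norm of `α + β X₀` over the polynomial ring in the remaining variables. -/
noncomputable def quadricNorm (p : Fin (m + 1) → F) (α β : MvPolynomial (Fin m) F) :
    MvPolynomial (Fin m) F :=
  α ^ 2 + β ^ 2 * (MvPolynomial.C (p 0)⁻¹ * formPoly fun i => p i.succ)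

theorem formPoly_dvd_mul_conj_sub_norm (p : Fin (m + 1) → F) (hp : p 0 ≠ 0)
    (α β : MvPolynomial (Fin m) F) :
    formPoly p ∣ (MvPolynomial.rename Fin.succ α + MvPolynomial.rename Fin.succ β *
      MvPolynomial.X 0) * (MvPolynomial.rename Fin.succ α - MvPolynomial.rename Fin.succ β *
      MvPolynomial.X 0) - MvPolynomial.rename Fin.succ (quadricNorm p α β) := by
  have hc : (MvPolynomial.C (p 0)⁻¹ * MvPolynomial.C (p 0) : MvPolynomial (Fin (m + 1)) F)
      = 1 := by
    rw [← MvPolynomial.C_mul, inv_mul_cancel₀ hp, MvPolynomial.C_1]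
  refine ⟨-(MvPolynomial.C (p 0)⁻¹ * MvPolynomial.rename Fin.succ β ^ 2), ?_⟩
  rw [formPoly_succ, quadricNorm]
  simp only [map_add, map_pow, map_mul, MvPolynomial.rename_C]
  linear_combination (MvPolynomial.rename Fin.succ β ^ 2 * MvPolynomial.X 0 ^ 2) * hc

theorem formPoly_dvd_conj (p : Fin (m + 1) → F) {α β : MvPolynomial (Fin m) F}
    (h : formPoly p ∣ MvPolynomial.rename Fin.succ α - MvPolynomial.rename Fin.succ β *
      MvPolynomial.X 0) :
    formPoly p ∣ MvPolynomial.rename Fin.succ α + MvPolynomial.rename Fin.succ β *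
      MvPolynomial.X 0 := by
  let χ : MvPolynomial (Fin (m + 1)) F →+* MvPolynomial (Fin (m + 1)) F :=
    MvPolynomial.eval₂Hom MvPolynomial.C
      (Fin.cons (-MvPolynomial.X 0) fun i => MvPolynomial.X i.succ)
  have hι (α : MvPolynomial (Fin m) F) :
      χ (MvPolynomial.rename Fin.succ α) = MvPolynomial.rename Fin.succ α := by
    have : χ.comp (MvPolynomial.rename Fin.succ).toRingHom =
        (MvPolynomial.rename (R := F) (Fin.succ (n := m))).toRingHom :=
      MvPolynomial.ringHom_ext (fun c => by simp [χ]) fun i => by simp [χ]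
    exact DFunLike.congr_fun this α
  have h0 : χ (MvPolynomial.X 0) = -MvPolynomial.X 0 := by simp [χ]
  have hC (c : F) : χ (MvPolynomial.C c) = MvPolynomial.C c := by simp [χ]
  have hp : χ (formPoly p) = formPoly p := by
    rw [formPoly_succ, map_add, map_mul, map_pow, hι, h0, hC, neg_sq]
  have := map_dvd χ h
  rwa [hp, map_sub, map_mul, hι, hι, h0, mul_neg, sub_neg_eq_add] at this

/-- A generic point of a quadric over an algebraically closed field. -/
theorem exists_generic_point (f : F →+* E) (p : Fin (m + 1) → F) (hp : p 0 ≠ 0) :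
    ∃ (Ω : Type v) (_ : Field Ω) (j : E →+* Ω) (x : Fin (m + 1) → Ω),
      evalQF (bc (j.comp f) p) x = 0 ∧
      Function.Injective (MvPolynomial.eval₂Hom j fun i : Fin m => x i.succ) := by
  let Ω := AlgebraicClosure (FractionRing (MvPolynomial (Fin m) E))
  let k : MvPolynomial (Fin m) E →+* Ω :=
    (algebraMap (FractionRing (MvPolynomial (Fin m) E)) Ω).comp (algebraMap _ _)
  have hk : Function.Injective k :=
    (algebraMap (FractionRing (MvPolynomial (Fin m) E)) Ω).injective.comp
      (IsFractionRing.injective _ _)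
  let j : E →+* Ω := k.comp MvPolynomial.C
  obtain ⟨x₀, hx₀⟩ := IsAlgClosed.exists_pow_nat_eq
    (-(j (f (p 0)))⁻¹ * ∑ i, j (f (p (Fin.succ i))) * k (MvPolynomial.X i) ^ 2) two_pos
  refine ⟨Ω, inferInstance, j, Fin.cons x₀ fun i => k (MvPolynomial.X i), ?_, ?_⟩
  · have : j (f (p 0)) ≠ 0 := by
      rw [← RingHom.comp_apply]
      exact (map_ne_zero _).2 hp
    simp only [evalQF, Fin.sum_univ_succ, bc, RingHom.comp_apply, Fin.cons_zero, Fin.cons_succ,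
      hx₀]
    rw [← mul_assoc, mul_neg, mul_inv_cancel₀ this]
    ring
  · convert hk
    simp only [Fin.cons_succ]
    refine MvPolynomial.ringHom_ext (fun c => ?_) fun i => ?_ <;> simp [j]

theorem injective_eval₂Hom_comp {Ω : Type*} [Field Ω] (f : F →+* E) {j : E →+* Ω} {x : Fin m → Ω}
    (h : Function.Injective (MvPolynomial.eval₂Hom j x)) :
    Function.Injective (MvPolynomial.eval₂Hom (j.comp f) x) := by
  convert h.comp (MvPolynomial.map_injective f f.injective)
  rw [← RingHom.coe_comp]
  congr 1
  refine MvPolynomial.ringHom_ext (fun c => ?_) fun i => ?_ <;> simp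

theorem eq_zero_of_formPoly_dvd_rename {p : Fin (m + 1) → F} (hp : p 0 ≠ 0)
    {α : MvPolynomial (Fin m) F} (h : formPoly p ∣ MvPolynomial.rename Fin.succ α) : α = 0 := by
  obtain ⟨Ω, _, j, x, hx, hinj⟩ := exists_generic_point (RingHom.id F) p hp
  have := map_dvd (MvPolynomial.eval₂Hom (j.comp (RingHom.id F)) x) h
  rw [eval₂Hom_formPoly, hx, zero_dvd_iff, eval₂Hom_rename_succ] at this
  exact hinj (by simpa using this)

theorem formPoly_ne_zero {p : Fin m → F} (hp : Nondeg p) (hm : 1 ≤ m) : formPoly p ≠ 0 := by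
  intro h
  let i : Fin m := ⟨0, hm⟩
  have := congrArg (MvPolynomial.eval₂Hom (RingHom.id F) (Pi.single i 1)) h
  rw [eval₂Hom_formPoly, map_zero, evalQF, Finset.sum_eq_single i (by simp +contextual)
    (by simp)] at this
  exact hp i (by simpa [bc] using this)

/-- A generic point of a quadric, not orthogonal to a given nonzero vector. -/
theorem exists_generic_point_not_orthogonal (h2 : (2 : E) ≠ 0) (f : F →+* E) {p : Fin (m + 1) → F}
    (hp : Nondeg p) (hm : 1 ≤ m) {e : Fin (m + 1) → E} (he : e ≠ 0) :
    ∃ (Ω : Type v) (_ : Field Ω) (j : E →+* Ω) (x : Fin (m + 1) → Ω),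
      evalQF (bc (j.comp f) p) x = 0 ∧
      Function.Injective (MvPolynomial.eval₂Hom j fun i : Fin m => x i.succ) ∧
      bilQF (bc (j.comp f) p) (fun i => j (e i)) x ≠ 0 := by
  obtain ⟨Ω, _, j, x, hx, hinj⟩ := exists_generic_point f p (hp 0)
  by_cases hB : bilQF (bc (j.comp f) p) (fun i => j (e i)) x = 0
  swap
  · exact ⟨Ω, _, j, x, hx, hinj, hB⟩
  refine ⟨Ω, _, j, Fin.cons (-x 0) fun i => x i.succ, ?_, by simpa using hinj, fun hB' => he ?_⟩
  · rw [← hx]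
    simp [evalQF, Fin.sum_univ_succ]
  have hx0 : x 0 ≠ 0 := by
    intro h0
    refine formPoly_ne_zero (fun i => hp (Fin.succ i)) hm
      (injective_eval₂Hom_comp f hinj ?_)
    rw [eval₂Hom_formPoly, map_zero, ← hx]
    simp [evalQF, Fin.sum_univ_succ, h0, bc]
  have h2' : (2 : Ω) ≠ 0 := by
    rw [← map_ofNat j 2]
    exact (map_ne_zero j).2 h2
  have hp0 (i) : j (f (p i)) ≠ 0 := by
    rw [← RingHom.comp_apply]
    exact (map_ne_zero _).2 (hp i)
  simp only [bilQF, Fin.sum_univ_succ, bc, Fin.cons_zero, Fin.cons_succ, RingHom.comp_apply]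
    at hB hB'
  have he0 : e 0 = 0 := by
    have : 2 * j (f (p 0)) * x 0 * j (e 0) = 0 := by linear_combination hB - hB'
    exact (map_eq_zero j).1 ((mul_eq_zero.1 this).resolve_left
      (mul_ne_zero (mul_ne_zero h2' (hp0 0)) hx0))
  rw [he0, map_zero, mul_zero, zero_mul, zero_add] at hB
  have hlin : ∑ i : Fin m, MvPolynomial.C (f (p i.succ) * e i.succ) * MvPolynomial.X i = 0 :=
    hinj (by simpa using hB)
  funext i
  refine Fin.cases he0 (fun i => ?_) i
  have := congrArg (MvPolynomial.eval₂Hom (RingHom.id E) (Pi.single i 1)) hlin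
  rw [map_zero, map_sum, Finset.sum_eq_single i (by simp +contextual) (by simp)] at this
  simpa [hp i.succ] using this

end Quadric

section FunField

variable {F E : Type*} [Field F] [Field E] {m n : ℕ}

theorem mk_eq_zero_iff {p : Fin n → F} {g : MvPolynomial (Fin n) F} :
    Ideal.Quotient.mk (Ideal.span {formPoly p}) g = 0 ↔ formPoly p ∣ g := by
  rw [Ideal.Quotient.eq_zero_iff_mem, Ideal.mem_span_singleton]

instance (p : Fin n → F) : Nontrivial (CoordRing p) := by
  refine Ideal.Quotient.nontrivial_iff.2 fun h => ?_
  have : formPoly p ∣ 1 := by rw [← Ideal.mem_span_singleton, h]; trivial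
  have := map_dvd (MvPolynomial.eval₂Hom (RingHom.id F) 0) this
  rw [eval₂Hom_formPoly, evalQF_zero, zero_dvd_iff, map_one] at this
  exact one_ne_zero this

/-- Over a field where `p` has a nontrivial zero, the quadric `p = 0` is rational. -/
theorem exists_ringHom_funField (h2 : (2 : E) ≠ 0) (f : F →+* E) {p : Fin (m + 1) → F}
    (hp : Nondeg p) (hm : 1 ≤ m) (h : Isotropic (bc f p)) :
    ∃ g : FunField p →+* FractionRing (MvPolynomial (Fin (m + 2)) E), ∀ c,
      g (algebraMap F (FunField p) c) = algebraMap E _ (f c) := by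
  obtain ⟨e, he, he0⟩ := h
  obtain ⟨Ω, _, j, x, hx, hinj, hB⟩ := exists_generic_point_not_orthogonal h2 f hp hm he
  let B := MvPolynomial (Fin (m + 2)) E
  let c : F →+* B := MvPolynomial.C.comp f
  let Y : Fin (m + 1) → B := fun i => MvPolynomial.X i.succ
  let e' : Fin (m + 1) → B := fun i => MvPolynomial.C (e i)
  let φ : Fin (m + 1) → B := evalQF (bc c p) Y • e' + (-2 * bilQF (bc c p) e' Y) • Y
  have hφ : evalQF (bc c p) φ = 0 := by
    have h1 : evalQF (bc c p) e' = 0 := by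
      have := evalQF_bc (MvPolynomial.C : E →+* B) (bc f p) e
      rw [he0, map_zero] at this
      exact this
    exact evalQF_reflection h1 Y
  let h : MvPolynomial (Fin (m + 1)) F →+* B := MvPolynomial.eval₂Hom c ((MvPolynomial.X 0 : B) • φ)
  have hh : h (formPoly p) = 0 := by
    rw [eval₂Hom_formPoly, evalQF_smul, hφ, mul_zero]
  have hdvd {g} (hg : formPoly p ∣ g) : h g = 0 := by
    have := map_dvd h hg
    rwa [hh, zero_dvd_iff] at this
  have h2' : (2 : Ω) ≠ 0 := by
    rw [← map_ofNat j 2]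
    exact (map_ne_zero j).2 h2
  let ev : B →+* Ω := MvPolynomial.eval₂Hom j
    (Fin.cons (-2 * bilQF (bc (j.comp f) p) (fun i => j (e i)) x)⁻¹ x)
  have hevC (a : E) : ev (MvPolynomial.C a) = j a := MvPolynomial.eval₂Hom_C _ _ _
  have hevY (i) : ev (Y i) = x i := MvPolynomial.eval₂Hom_X' _ _ _
  have hevc : bc ev (bc c p) = bc (j.comp f) p := by
    ext i
    simp [bc, c, hevC]
  have hevφ (i) : ev (((MvPolynomial.X 0 : B) • φ) i) = x i := by
    have h1 : ev (evalQF (bc c p) Y) = 0 := by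
      rw [← evalQF_bc, hevc]
      simpa only [hevY] using hx
    have h3 : ev (bilQF (bc c p) e' Y) = bilQF (bc (j.comp f) p) (fun i => j (e i)) x := by
      simp [bilQF, bc, c, hevC, hevY, e']
    have h4 : ev (MvPolynomial.X 0) =
      (-2 * bilQF (bc (j.comp f) p) (fun i => j (e i)) x)⁻¹ := MvPolynomial.eval₂Hom_X' _ _ _
    simp only [Pi.smul_apply, smul_eq_mul, map_mul, φ, Pi.add_apply, map_add, h1, h3, h4, hevY,
      zero_mul, zero_add, map_neg, map_ofNat]
    rw [← mul_assoc, inv_mul_cancel₀ (mul_ne_zero (neg_ne_zero.2 h2') hB), one_mul]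
  have hcomp : ev.comp h = MvPolynomial.eval₂Hom (j.comp f) x := by
    refine MvPolynomial.ringHom_ext (fun a => ?_) fun i => ?_
    · simp [h, c, hevC]
    · rw [RingHom.comp_apply, MvPolynomial.eval₂Hom_X', MvPolynomial.eval₂Hom_X', hevφ]
  have hne {α : MvPolynomial (Fin m) F} (hα : α ≠ 0) :
      h (MvPolynomial.rename Fin.succ α) ≠ 0 := by
    intro h0
    have := congrArg ev h0
    rw [← RingHom.comp_apply, hcomp, eval₂Hom_rename_succ, map_zero] at this
    exact hα (injective_eval₂Hom_comp f hinj (by rw [this, map_zero]))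
  let h' : CoordRing p →+* FractionRing B := (algebraMap B (FractionRing B)).comp
    (Ideal.Quotient.lift _ h fun g hg => hdvd (Ideal.mem_span_singleton.1 hg))
  have hunit (s : nonZeroDivisors (CoordRing p)) : IsUnit (h' s) := by
    obtain ⟨s, hs⟩ := s
    obtain ⟨g, rfl⟩ := Ideal.Quotient.mk_surjective s
    rw [isUnit_iff_ne_zero]
    refine (map_ne_zero_iff _ (IsFractionRing.injective B (FractionRing B))).2 ?_
    change h g ≠ 0
    obtain ⟨α, β, hg⟩ := exists_linear_mod_formPoly p (hp 0) g
    have hd := formPoly_dvd_mul_conj_sub_norm p (hp 0) α β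
    have hmk := mk_eq_zero_iff.2 hg
    rw [map_sub, sub_eq_zero] at hmk
    have hN : quadricNorm p α β ≠ 0 := by
      intro hN
      rw [hN, map_zero, sub_zero, ← mk_eq_zero_iff, map_mul, ← hmk] at hd
      have := formPoly_dvd_conj p (mk_eq_zero_iff.1
        ((mul_left_mem_nonZeroDivisors_eq_zero_iff hs).1 hd))
      rw [← mk_eq_zero_iff, ← hmk] at this
      exact nonZeroDivisors.ne_zero hs this
    have h1 := hdvd hg
    have h3 := hdvd hd
    rw [map_sub, sub_eq_zero] at h1 h3
    rw [h1]
    refine left_ne_zero_of_mul (b := h (MvPolynomial.rename Fin.succ α -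
      MvPolynomial.rename Fin.succ β * MvPolynomial.X 0)) ?_
    rw [← map_mul, h3]
    exact hne hN
  refine ⟨IsLocalization.lift hunit, fun a => ?_⟩
  rw [IsScalarTower.algebraMap_apply F (CoordRing p) (FunField p), IsLocalization.lift_eq]
  change algebraMap B (FractionRing B) (h (MvPolynomial.C a)) = _
  simp only [h, MvPolynomial.eval₂Hom_C]
  rw [IsScalarTower.algebraMap_apply E B (FractionRing B)]
  rfl

theorem wittIndex_funField_le (h2 : (2 : F) ≠ 0) (f : F →+* E) {p : Fin m → F}
    (hp : Nondeg p) (hm : 2 ≤ m) (h : Isotropic (bc f p)) {q : Fin n → F} (hq : Nondeg q) :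
    WittIndex (bc (algebraMap F (FunField p)) q) ≤ WittIndex (bc f q) := by
  obtain ⟨m, rfl⟩ : ∃ k, m = k + 1 := ⟨m - 1, by omega⟩
  have h2E : (2 : E) ≠ 0 := by
    rw [← map_ofNat f 2]
    exact (map_ne_zero f).2 h2
  have h2' : IsUnit (2 : FunField p) := by
    rw [← map_ofNat (algebraMap F (FunField p)) 2]
    exact (isUnit_iff_ne_zero.2 h2).map _
  obtain ⟨g, hg⟩ := exists_ringHom_funField h2E f hp (by omega) h
  refine (wittIndex_le_bc h2' g _).trans ?_
  rw [show bc g (bc (algebraMap F (FunField p)) q) = bc (algebraMap E _) (bc f q) from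
    funext fun i => hg (q i)]
  exact wittIndex_fractionRing_mvPolynomial_le h2E fun i => (map_ne_zero f).2 (hq i)

theorem wittIndex_funField_of_isotropic (h2 : (2 : F) ≠ 0) {p : Fin m → F}
    (hp : Nondeg p) (hm : 2 ≤ m) (h : Isotropic p) {q : Fin n → F} (hq : Nondeg q) :
    WittIndex (bc (algebraMap F (FunField p)) q) = WittIndex q :=
  le_antisymm (wittIndex_funField_le h2 (RingHom.id F) hp hm h hq)
    (wittIndex_le_bc (isUnit_iff_ne_zero.2 h2) _ _)

theorem isDomain_coordRing {p : Fin m → F} (hp : Nondeg p) (hm : 2 ≤ m) (h : Anisotropic p) :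
    IsDomain (CoordRing p) := by
  obtain ⟨m, rfl⟩ : ∃ k, m = k + 1 := ⟨m - 1, by omega⟩
  have key (α β : MvPolynomial (Fin m) F) (hN : quadricNorm p α β = 0) : α = 0 ∧ β = 0 := by
    have hc : (MvPolynomial.C (p 0) * MvPolynomial.C (p 0)⁻¹ : MvPolynomial (Fin m) F) = 1 := by
      rw [← MvPolynomial.C_mul, mul_inv_cancel₀ (hp 0), MvPolynomial.C_1]
    have := eq_zero_of_evalQF_mvPolynomial h
      (v := Fin.cons α fun i => β * MvPolynomial.X i) (by
        simp only [evalQF, bc, Fin.sum_univ_succ, Fin.cons_zero, Fin.cons_succ]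
        have hs : ∑ i : Fin m, MvPolynomial.C (p i.succ) * (β * MvPolynomial.X i) ^ 2 =
            β ^ 2 * formPoly fun i => p i.succ := by
          rw [formPoly, Finset.mul_sum]
          exact Finset.sum_congr rfl fun i _ => by ring
        rw [hs]
        rw [quadricNorm] at hN
        linear_combination MvPolynomial.C (p 0) * hN -
          β ^ 2 * (formPoly fun i => p i.succ) * hc)
    refine ⟨by simpa using congrFun this 0, ?_⟩
    have : β * MvPolynomial.X ⟨0, by omega⟩ = 0 := congrFun this (Fin.succ ⟨0, by omega⟩)
    exact (mul_eq_zero.1 this).resolve_right (MvPolynomial.X_ne_zero _)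
  have : NoZeroDivisors (CoordRing p) := by
    refine ⟨fun {s t} hst => ?_⟩
    obtain ⟨g, rfl⟩ := Ideal.Quotient.mk_surjective s
    obtain ⟨g', rfl⟩ := Ideal.Quotient.mk_surjective t
    obtain ⟨α, β, hg⟩ := exists_linear_mod_formPoly p (hp 0) g
    obtain ⟨α', β', hg'⟩ := exists_linear_mod_formPoly p (hp 0) g'
    have hd := mk_eq_zero_iff.2 (formPoly_dvd_mul_conj_sub_norm p (hp 0) α β)
    have hd' := mk_eq_zero_iff.2 (formPoly_dvd_mul_conj_sub_norm p (hp 0) α' β')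
    rw [← mk_eq_zero_iff, map_sub, sub_eq_zero] at hg hg'
    rw [map_sub, sub_eq_zero, map_mul] at hd hd'
    rw [← hg] at hd
    rw [← hg'] at hd'
    have : quadricNorm p α β * quadricNorm p α' β' = 0 := by
      refine eq_zero_of_formPoly_dvd_rename (hp 0) (mk_eq_zero_iff.1 ?_)
      rw [map_mul, map_mul, ← hd, ← hd', mul_mul_mul_comm, hst, zero_mul]
    rcases mul_eq_zero.1 this with h0 | h0
    · left
      obtain ⟨rfl, rfl⟩ := key _ _ h0
      simpa using hg
    · right
      obtain ⟨rfl, rfl⟩ := key _ _ h0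
      simpa using hg'
  exact NoZeroDivisors.to_isDomain _

theorem isotropic_funField {p : Fin m → F} (hp : Nondeg p) (hm : 2 ≤ m) :
    Isotropic (bc (algebraMap F (FunField p)) p) := by
  obtain ⟨m, rfl⟩ : ∃ k, m = k + 1 := ⟨m - 1, by omega⟩
  let f : MvPolynomial (Fin (m + 1)) F →+* FunField p :=
    (algebraMap (CoordRing p) (FunField p)).comp (Ideal.Quotient.mk _)
  refine ⟨fun i => f (MvPolynomial.X i), fun h => ?_, ?_⟩
  · have := congrFun h (Fin.succ ⟨0, by omega⟩)
    rw [Pi.zero_apply, RingHom.comp_apply,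
      map_eq_zero_iff _ (IsFractionRing.injective (CoordRing p) (FunField p)), mk_eq_zero_iff,
      ← MvPolynomial.rename_X] at this
    exact MvPolynomial.X_ne_zero _ (eq_zero_of_formPoly_dvd_rename (hp 0) this)
  · have := evalQF_bc f (bc MvPolynomial.C p) MvPolynomial.X
    rw [show evalQF (bc MvPolynomial.C p) MvPolynomial.X = formPoly p from rfl,
      RingHom.comp_apply, mk_eq_zero_iff.2 dvd_rfl, map_zero] at this
    exact this

end FunField

section Transfer

variable {F L : Type*} [Field F] [Field L] {m n N : ℕ}

theorem Isotropic.bc {f : F →+* L} {d : Fin n → F} (h : Isotropic d) : Isotropic (QF.bc f d) := by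
  obtain ⟨v, hv, h0⟩ := h
  refine ⟨fun i => f (v i), fun h => hv (funext fun i => ?_), by rw [evalQF_bc, h0, map_zero]⟩
  exact (map_eq_zero f).1 (congrFun h i)

theorem IsDouble.isotropic {t : L} {q : Fin n → L} {Q : Fin N → L} (h : IsDouble t q Q)
    (hq : Isotropic q) : Isotropic Q := by
  obtain ⟨v, hv, h0⟩ := hq
  obtain ⟨Ψ, hΨ⟩ := h.exists_equiv
  refine ⟨Ψ.symm (v, 0), fun h => hv ?_, by rw [hΨ]; simp [h0, evalQF_zero]⟩
  exact congrArg Prod.fst (Ψ.symm.map_eq_zero_iff.1 h)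

theorem evalQF_smul_sub_smul {R : Type*} [CommRing R] (d u v : Fin n → R) (s : R)
    (hs : s ^ 2 = bilQF d u v ^ 2 - evalQF d u * evalQF d v) :
    evalQF d (evalQF d v • u - (bilQF d u v + s) • v) = 0 := by
  have h (a b : R) : evalQF d (a • u - b • v) =
      a ^ 2 * evalQF d u + b ^ 2 * evalQF d v - 2 * (a * b * bilQF d u v) := by
    simp only [evalQF, bilQF, Finset.mul_sum, ← Finset.sum_add_distrib, ← Finset.sum_sub_distrib,
      Pi.sub_apply, Pi.smul_apply, smul_eq_mul]
    exact Finset.sum_congr rfl fun i _ => by ring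
  rw [h]
  linear_combination evalQF d v * hs

theorem two_mul_wittIndex_le {R : Type*} [CommRing R] [Nontrivial R] (d : Fin n → R) :
    2 * WittIndex d ≤ n := by
  obtain ⟨m, r, h⟩ := exists_isometric_wittIndex d
  have := finrank_of_isometric h
  omega

theorem evalQF_quadraticAlgebra {δ : L} (d : Fin n → L) (w : Fin n → QuadraticAlgebra L δ 0) :
    (evalQF (bc (algebraMap L _) d) w).re =
      evalQF d (fun i => (w i).re) + δ * evalQF d (fun i => (w i).im) ∧
    (evalQF (bc (algebraMap L _) d) w).im =
      2 * bilQF d (fun i => (w i).re) (fun i => (w i).im) := by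
  let re : QuadraticAlgebra L δ 0 →+ L := ⟨⟨QuadraticAlgebra.re, rfl⟩, fun _ _ => rfl⟩
  let im : QuadraticAlgebra L δ 0 →+ L := ⟨⟨QuadraticAlgebra.im, rfl⟩, fun _ _ => rfl⟩
  constructor
  · change re _ = _
    simp only [evalQF, map_sum, Finset.mul_sum, ← Finset.sum_add_distrib]
    refine Finset.sum_congr rfl fun i _ => ?_
    simp [re, bc, sq]
    ring
  · change im _ = _
    simp only [evalQF, bilQF, map_sum, Finset.mul_sum]
    refine Finset.sum_congr rfl fun i _ => ?_
    simp [im, bc, sq]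
    ring

theorem isotropic_quadraticAlgebra (d u : Fin m → L) {v : Fin m → L} (hv : v ≠ 0) {δ : L}
    (hδ : δ = bilQF d u v ^ 2 - evalQF d u * evalQF d v) :
    Isotropic (bc (algebraMap L (QuadraticAlgebra L δ 0)) d) := by
  let i := algebraMap L (QuadraticAlgebra L δ 0)
  have hω : (QuadraticAlgebra.omega : QuadraticAlgebra L δ 0) ^ 2 = i δ := by
    rw [sq, QuadraticAlgebra.omega_mul_omega_eq_mk]
    rfl
  have e1 : evalQF (bc i d) (fun k => i (u k)) = i (evalQF d u) := evalQF_bc i d u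
  have e2 : evalQF (bc i d) (fun k => i (v k)) = i (evalQF d v) := evalQF_bc i d v
  have e3 : bilQF (bc i d) (fun k => i (u k)) (fun k => i (v k)) = i (bilQF d u v) := by
    simp [bilQF, bc]
  have e4 : i δ = i (bilQF d u v) ^ 2 - i (evalQF d u) * i (evalQF d v) :=
    (congrArg i hδ).trans (by simp only [map_sub, map_pow, map_mul])
  refine ⟨_, fun h0 => hv ?_, evalQF_smul_sub_smul (bc i d) (fun k => i (u k))
    (fun k => i (v k)) QuadraticAlgebra.omega (by rw [e1, e2, e3, hω, e4])⟩
  rw [e2, e3] at h0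
  funext k
  simpa [i] using congrArg QuadraticAlgebra.im (congrFun h0 k)

theorem IsDouble.two_mul_wittIndex_quadraticAlgebra_le (h2 : (2 : L) ≠ 0) {t b c δ : L}
    (ht : t ≠ 0) (hb : b ≠ 0) (hδ : δ = c ^ 2 - t * b ^ 2) (hδ0 : δ ≠ 0)
    [Fact (∀ r : L, r ^ 2 ≠ δ + 0 * r)] {d : Fin n → L} (hd : Nondeg d) {Q : Fin N → L}
    (hQ : IsDouble t d Q) :
    2 * WittIndex (QF.bc (algebraMap L (QuadraticAlgebra L δ 0)) d) ≤ WittIndex Q := by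
  obtain ⟨g, hg, h0⟩ := exists_totally_isotropic
    (QF.bc (algebraMap L (QuadraticAlgebra L δ 0)) d)
  generalize WittIndex (QF.bc (algebraMap L (QuadraticAlgebra L δ 0)) d) = k at *
  let G : (Fin k → QuadraticAlgebra L δ 0) →ₗ[L] (Fin n → L) × (Fin n → L) :=
    { toFun := fun w => ((c / b) • (fun l => (g w l).re) + (δ / b) • (fun l => (g w l).im),
        fun l => (g w l).re)
      map_add' := fun x y => by
        ext l <;> simp
        ring
      map_smul' := fun r x => by
        have : g (r • x) = r • g x := g.map_smul_of_tower r x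
        ext l <;> simp [this]
        ring }
  have hG (w) : evalQF d (G w).1 = t * evalQF d (G w).2 := by
    obtain ⟨h4, h5⟩ := evalQF_quadraticAlgebra d (g w)
    rw [h0] at h4 h5
    change evalQF d ((c / b) • (fun l => (g w l).re) + (δ / b) • (fun l => (g w l).im)) =
      t * evalQF d (fun l => (g w l).re)
    have hbil (x y : L) (A B : Fin n → L) (hAB : bilQF d A B = 0) :
        evalQF d (x • A + y • B) = x ^ 2 * evalQF d A + y ^ 2 * evalQF d B := by
      have : bilQF d (x • A) (y • B) = x * y * bilQF d A B := bilQF_smul_smul d A B x y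
      rw [evalQF_add, evalQF_smul, evalQF_smul, this, hAB]
      ring
    rw [hbil _ _ _ _ ((mul_eq_zero.1 h5.symm).resolve_left h2)]
    change 0 = _ at h4
    field_simp
    linear_combination -δ * h4 - evalQF d (fun l => (g w l).re) * hδ
  have hGinj : Function.Injective G := by
    rw [injective_iff_map_eq_zero]
    intro w hw
    have h3 : (fun l => (g w l).re) = 0 := congrArg Prod.snd hw
    have h4 : (c / b) • (fun l => (g w l).re) + (δ / b) • (fun l => (g w l).im) = 0 :=
      congrArg Prod.fst hw
    rw [h3, smul_zero, zero_add] at h4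
    have h5 := (smul_eq_zero.1 h4).resolve_left (div_ne_zero hδ0 hb)
    refine hg ?_
    rw [map_zero]
    funext l
    exact QuadraticAlgebra.ext (congrFun h3 l) (congrFun h5 l)
  have := hQ.finrank_le_wittIndex h2 ht hd G hGinj hG
  rw [Module.finrank_pi_fintype] at this
  simp only [QuadraticAlgebra.finrank_eq_two, Finset.sum_const, Finset.card_univ,
    Fintype.card_fin, smul_eq_mul] at this
  omega

/-- If `⟨1, -t⟩ ⊗ p` is isotropic over `L`, then the totally isotropic subspaces of `q` over the
function field of `p` descend to totally isotropic subspaces of `⟨1, -t⟩ ⊗ q` over `L`. -/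
theorem two_mul_wittIndex_funField_le (h2 : (2 : F) ≠ 0) (f : F →+* L) {p : Fin m → F}
    (hp : Nondeg p) (hm : 2 ≤ m) {q : Fin n → F} (hq : Nondeg q) {t : L} (ht : t ≠ 0)
    {Q : Fin N → L} (hQ : IsDouble t (bc f q) Q) {u v : Fin m → L} (huv : ¬ (u = 0 ∧ v = 0))
    (h : evalQF (bc f p) u = t * evalQF (bc f p) v) :
    2 * WittIndex (bc (algebraMap F (FunField p)) q) ≤ WittIndex Q := by
  have h2L : (2 : L) ≠ 0 := by
    rw [← map_ofNat f 2]
    exact (map_ne_zero f).2 h2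
  have hqL : Nondeg (bc f q) := fun i => (map_ne_zero f).2 (hq i)
  by_cases hiso : Isotropic (bc f p)
  · exact (Nat.mul_le_mul_left 2 (wittIndex_funField_le h2 f hp hm hiso hq)).trans
      (hQ.two_mul_wittIndex_le h2L ht hqL)
  have haniso {w} (hw : evalQF (bc f p) w = 0) : w = 0 := by_contra fun hw0 => hiso ⟨w, hw0, hw⟩
  set a := evalQF (bc f p) u with ha
  set b := evalQF (bc f p) v with hb
  set c := bilQF (bc f p) u v with hc
  have hv : v ≠ 0 := by
    rintro rfl
    rw [hb, evalQF_zero, mul_zero] at h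
    exact huv ⟨haniso h, rfl⟩
  have hb0 : b ≠ 0 := fun h0 => hv (haniso h0)
  by_cases hδ : ∃ s, s ^ 2 = c ^ 2 - a * b
  · obtain ⟨s, hs⟩ := hδ
    have h1 := haniso (evalQF_smul_sub_smul (bc f p) u v s hs)
    rw [sub_eq_zero] at h1
    have h3 : b ^ 2 * a = (c + s) ^ 2 * b := by
      rw [ha, ← evalQF_smul, h1, evalQF_smul]
    have hts : ((c + s) / b) ^ 2 = t := by
      rw [div_pow, div_eq_iff (pow_ne_zero 2 hb0)]
      refine mul_right_cancel₀ hb0 ?_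
      rw [← h3, h]
      ring
    have := hQ.finrank_le_wittIndex h2L ht hqL
      (LinearMap.prod (((c + s) / b) • LinearMap.id) LinearMap.id)
      (fun x y hxy => congrArg Prod.snd hxy) fun w => by
        change evalQF (bc f q) (((c + s) / b) • w) = t * evalQF (bc f q) w
        rw [evalQF_smul, hts]
    rw [Module.finrank_fin_fun] at this
    have : Nontrivial (FunField p) :=
      (IsFractionRing.injective (CoordRing p) (FunField p)).nontrivial
    exact (two_mul_wittIndex_le _).trans ‹n ≤ _›
  · obtain ⟨δ, hδdef⟩ : ∃ δ, δ = c ^ 2 - a * b := ⟨_, rfl⟩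
    rw [← hδdef] at hδ
    have hfact : Fact (∀ r : L, r ^ 2 ≠ δ + 0 * r) :=
      ⟨fun r hr => hδ ⟨r, by rw [hr, zero_mul, add_zero]⟩⟩
    have hδ0 : δ ≠ 0 := fun h0 => hδ ⟨0, by rw [h0, zero_pow two_ne_zero]⟩
    refine (Nat.mul_le_mul_left 2 (wittIndex_funField_le h2
      ((algebraMap L (QuadraticAlgebra L δ 0)).comp f) hp hm
      (isotropic_quadraticAlgebra (bc f p) u hv hδdef) hq)).trans ?_
    exact hQ.two_mul_wittIndex_quadraticAlgebra_le h2L ht hb0 (c := c)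
      (by rw [hδdef, h]; ring) hδ0 hqL

end Transfer

section LaurentStep

/-- The coefficientwise extension of a ring homomorphism to Laurent series. -/
noncomputable def laurentMap {R S : Type*} [CommRing R] [CommRing S] (f : R →+* S) :
    LaurentSeries R →+* LaurentSeries S where
  toFun x := x.map (f : R →ₙ+* S)
  map_one' := (HahnSeries.map_single (f : ZeroHom R S)).trans (by simp)
  map_mul' x y := HahnSeries.map_mul (f : R →ₙ+* S)
  map_zero' := by ext; simp
  map_add' x y := by ext; simp

theorem laurentMap_single {R S : Type*} [CommRing R] [CommRing S] (f : R →+* S) (a : ℤ) (c : R) :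
    laurentMap f (HahnSeries.single a c) = HahnSeries.single a (f c) :=
  HahnSeries.map_single (f : ZeroHom R S)

variable {F : Type*} [Field F] {m n M N : ℕ}

theorem wittIndex_funField_double_laurent (h2 : (2 : F) ≠ 0) {p : Fin m → F} {q : Fin n → F}
    (hp : Nondeg p) (hq : Nondeg q) (hm : 2 ≤ m)
    {P : Fin M → LaurentSeries F} {Q : Fin N → LaurentSeries F}
    (hP : IsDouble (HahnSeries.single 1 1) (bc (HahnSeries.C : F →+* LaurentSeries F) p) P)
    (hQ : IsDouble (HahnSeries.single 1 1) (bc (HahnSeries.C : F →+* LaurentSeries F) q) Q) :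
    WittIndex (bc (algebraMap (LaurentSeries F) (FunField P)) Q) =
      2 * WittIndex (bc (algebraMap F (FunField p)) q) := by
  let c : F →+* LaurentSeries F := HahnSeries.C
  have hx : (HahnSeries.single 1 1 : LaurentSeries F) ≠ 0 := by simp
  have h2' : (2 : LaurentSeries F) ≠ 0 := by
    rw [← map_ofNat c 2]; exact (map_ne_zero c).2 h2
  have hbc {k : ℕ} {d : Fin k → F} (hd : Nondeg d) : Nondeg (bc c d) :=
    fun i => (map_ne_zero c).2 (hd i)
  have hPn : Nondeg P := hP.nondeg hx (hbc hp)
  have hQn : Nondeg Q := hQ.nondeg hx (hbc hq)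
  have hM : 2 ≤ M := by have := hP.card; omega
  by_cases hpi : Isotropic p
  · rw [wittIndex_funField_of_isotropic h2 hp hm hpi hq, wittIndex_funField_of_isotropic h2' hPn hM
      (hP.isotropic hpi.bc) hQn, wittIndex_double_laurent h2 hq hQ]
  have hPa : Anisotropic P := anisotropic_double_laurent hpi hP
  have := isDomain_coordRing hp hm hpi
  have := isDomain_coordRing hPn hM hPa
  let g := algebraMap F (FunField p)
  let φ := laurentMap g
  have hφ (t : ℕ) (d : Fin t → F) : bc φ (bc HahnSeries.C d) = bc HahnSeries.C (bc g d) :=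
    funext fun i => laurentMap_single g 0 (d i)
  have hφx : φ (HahnSeries.single 1 1) = HahnSeries.single 1 1 := by
    rw [laurentMap_single, map_one]
  apply le_antisymm
  · have hP' := hP.bc φ
    have hQ' := hQ.bc φ
    rw [hφ, hφx] at hP' hQ'
    have h2E : (2 : FunField p) ≠ 0 := by
      rw [← map_ofNat g 2]; exact (map_ne_zero g).2 h2
    exact (wittIndex_funField_le h2' φ hPn hM
      (hP'.isotropic (isotropic_funField hp hm).bc) hQn).trans
        (wittIndex_double_laurent h2E (fun i => (map_ne_zero g).2 (hq i)) hQ').le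
  · let h := algebraMap (LaurentSeries F) (FunField P)
    obtain ⟨Ψ, hΨ⟩ := (hP.bc h).exists_equiv
    obtain ⟨w, hw, hw0⟩ := isotropic_funField hPn hM
    refine two_mul_wittIndex_funField_le h2 (h.comp c) hp hm hq ((map_ne_zero h).2 hx) (hQ.bc h)
      (u := (Ψ w).1) (v := (Ψ w).2) (fun h0 => hw ?_) (sub_eq_zero.1 ((hΨ w).symm.trans hw0))
    exact Ψ.map_eq_zero_iff.1 (Prod.ext h0.1 h0.2)

end LaurentStep

section Pfister

variable {R S : Type*} [CommRing R] [CommRing S] {m n : ℕ}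

theorem tensorQF_apply (d : Fin m → R) (e : Fin n → R) (i : Fin m) (j : Fin n) :
    tensorQF d e (finProdFinEquiv (i, j)) = d i * e j := by
  simp [tensorQF]

theorem pfisterOf_apply (a : Fin n → R) (s : Fin n → Fin 2) :
    pfisterOf a (finFunctionFinEquiv s) = ∏ j, if s j = 0 then 1 else a j := by
  simp only [pfisterOf, Equiv.symm_apply_apply]

theorem isDouble_tensorQF_pfisterOf (c : R →+* S) {t : S} (a : Fin n → R) (a' : Fin (n + 1) → S)
    (h1 : ∀ j, a' (Fin.castSucc j) = c (a j)) (h2 : a' (Fin.last n) = -t) (d : Fin m → R) :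
    IsDouble t (bc c (tensorQF (pfisterOf a) d)) (tensorQF (pfisterOf a') (bc c d)) := by
  let ψ (b : Fin 2) : Fin (2 ^ n * m) → Fin (2 ^ (n + 1) * m) := fun i =>
    finProdFinEquiv (finFunctionFinEquiv
      (Fin.snoc (α := fun _ => Fin 2) (finFunctionFinEquiv.symm (finProdFinEquiv.symm i).1) b),
      (finProdFinEquiv.symm i).2)
  have hψ (b i) : tensorQF (pfisterOf a') (bc c d) (ψ b i) =
      (if b = 0 then 1 else -t) * bc c (tensorQF (pfisterOf a) d) i := by
    obtain ⟨⟨k, l⟩, rfl⟩ := finProdFinEquiv.surjective i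
    obtain ⟨s, rfl⟩ := finFunctionFinEquiv.surjective k
    simp only [ψ, Equiv.symm_apply_apply, tensorQF_apply, pfisterOf_apply, bc, map_mul, map_prod,
      Fin.prod_univ_castSucc, Fin.snoc_castSucc, Fin.snoc_last, h1, h2, apply_ite c, map_one]
    ring
  have hinj (b b' i i') (h : ψ b i = ψ b' i') : b = b' ∧ i = i' := by
    have h := finProdFinEquiv.injective h
    rw [Prod.mk.injEq, finFunctionFinEquiv.injective.eq_iff, Fin.snoc_inj,
      finFunctionFinEquiv.symm.injective.eq_iff] at h
    exact ⟨h.1.2, finProdFinEquiv.symm.injective (Prod.ext h.1.1 h.2)⟩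
  let σ : Fin (2 ^ n * m) ⊕ Fin (2 ^ n * m) → Fin (2 ^ (n + 1) * m) := Sum.elim (ψ 0) (ψ 1)
  have hσ : Function.Bijective σ := by
    rw [Fintype.bijective_iff_injective_and_card]
    refine ⟨?_, by simp [pow_succ]; ring⟩
    rintro (i | i) (j | j) h
    · rw [(hinj _ _ _ _ h).2]
    · exact absurd (hinj _ _ _ _ h).1 (by decide)
    · exact absurd (hinj _ _ _ _ h).1 (by decide)
    · rw [(hinj _ _ _ _ h).2]
  exact ⟨Equiv.ofBijective σ hσ, fun i => (hψ 0 i).trans (by simp),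
    fun i => (hψ 1 i).trans (by simp)⟩

theorem Nondeg.tensorQF [NoZeroDivisors R] {d : Fin m → R} {e : Fin n → R} (hd : Nondeg d)
    (he : Nondeg e) : Nondeg (tensorQF d e) :=
  fun _ => mul_ne_zero (hd _) (he _)

theorem nondeg_pfisterOf [IsDomain R] {a : Fin n → R} (ha : ∀ i, a i ≠ 0) :
    Nondeg (pfisterOf a) := by
  intro i
  refine Finset.prod_ne_zero_iff.2 fun j _ => ?_
  split_ifs
  exacts [one_ne_zero, ha j]

theorem tensorQF_pfisterOf_zero (a : Fin 0 → R) (d : Fin m → R) (i : Fin (2 ^ 0 * m)) :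
    tensorQF (pfisterOf a) d i = d (Fin.cast (by simp) i) := by
  obtain ⟨⟨k, l⟩, rfl⟩ := finProdFinEquiv.surjective i
  rw [tensorQF_apply, show pfisterOf a k = 1 from Fin.prod_univ_zero _, one_mul]
  exact congrArg d (Fin.ext (by simp))

theorem wittIndex_funField_congr {F : Type*} [Field F] {k l : ℕ} {p : Fin k → F} {p' : Fin m → F}
    {q : Fin l → F} {q' : Fin n → F} (hk : k = m) (hl : l = n)
    (hp : ∀ i, p i = p' (Fin.cast hk i)) (hq : ∀ i, q i = q' (Fin.cast hl i)) :
    WittIndex (bc (algebraMap F (FunField p)) q) =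
      WittIndex (bc (algebraMap F (FunField p')) q') := by
  subst hk hl
  obtain rfl : p = p' := funext hp
  obtain rfl : q = q' := funext hq
  rfl

end Pfister

section IterLaurent

variable {F : Type u} [Field F]

theorem xvar_castSucc (n : ℕ) (i : Fin n) : xvar F (n + 1) i.castSucc =
    (HahnSeries.C (xvar F n i) : LaurentSeries (IterLaurent F n)) :=
  dif_pos i.2

theorem xvar_last (n : ℕ) : xvar F (n + 1) (Fin.last n) =
    (HahnSeries.single 1 1 : LaurentSeries (IterLaurent F n)) :=
  dif_neg (lt_irrefl n)

theorem xvar_ne_zero : ∀ (n : ℕ) (i : Fin n), xvar F n i ≠ 0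
  | 0, i => i.elim0
  | n + 1, i => by
    induction i using Fin.lastCases with
    | last =>
      rw [xvar_last]
      exact HahnSeries.single_ne_zero one_ne_zero
    | cast i =>
      rw [xvar_castSucc]
      exact (map_ne_zero (HahnSeries.C : IterLaurent F n →+* _)).2 (xvar_ne_zero n i)

theorem isDouble_iterLaurent {m : ℕ} (p : Fin m → F) (n : ℕ) :
    IsDouble (R := LaurentSeries (IterLaurent F n)) (HahnSeries.single 1 1)
      (bc HahnSeries.C (tensorQF (pfisterOf fun i => -(xvar F n i)) (bc (iterEmb F n) p)))
      (tensorQF (pfisterOf fun i => -(xvar F (n + 1) i)) (bc (iterEmb F (n + 1)) p)) :=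
  isDouble_tensorQF_pfisterOf (S := LaurentSeries (IterLaurent F n)) HahnSeries.C _ _
    (fun j => by rw [map_neg, xvar_castSucc]; rfl) (by rw [xvar_last]; rfl) _

theorem nondeg_iterLaurent {m : ℕ} {p : Fin m → F} (hp : Nondeg p) (n : ℕ) :
    Nondeg (tensorQF (pfisterOf fun i => -(xvar F n i)) (bc (iterEmb F n) p)) :=
  (nondeg_pfisterOf fun i => neg_ne_zero.2 (xvar_ne_zero n i)).tensorQF
    fun i => (map_ne_zero (iterEmb F n)).2 (hp i)

end IterLaurent

end QF

open QF in
/-- Let `p`, `q` be forms over `F` (char `F ≠ 2`) of dimension at least two, let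
`K = F((x₁))…((xₙ))` and let `π = ⟨1,-x₁⟩ ⊗ … ⊗ ⟨1,-xₙ⟩` over `K`. Then
`i((π ⊗ q)_{K(π ⊗ p)}) = (dim π) · i(q_{F(p)})`. -/
theorem stmt_11 {F : Type u} [Field F] (h2 : (2 : F) ≠ 0)
    {np nq : ℕ} (p : Fin np → F) (q : Fin nq → F)
    (hp : Nondeg p) (hq : Nondeg q) (hp2 : 2 ≤ np) (hq2 : 2 ≤ nq) (n : ℕ) :
    WittIndex
      (bc (algebraMap (IterLaurent F n)
          (FunField (tensorQF (pfisterOf (fun i => -(xvar F n i))) (bc (iterEmb F n) p))))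
        (tensorQF (pfisterOf (fun i => -(xvar F n i))) (bc (iterEmb F n) q)))
      = 2 ^ n * WittIndex (bc (algebraMap F (FunField p)) q) := by
  induction n with
  | zero =>
    exact (wittIndex_funField_congr (F := F) (by simp) (by simp) (tensorQF_pfisterOf_zero _ _)
      (tensorQF_pfisterOf_zero _ _)).trans (one_mul _).symm
  | succ n ih =>
    have h2n : (2 : IterLaurent F n) ≠ 0 := by
      rw [← map_ofNat (iterEmb F n) 2]
      exact (map_ne_zero _).2 h2
    have hdim : 2 ≤ 2 ^ n * np := hp2.trans (Nat.le_mul_of_pos_left _ (by positivity))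
    exact (wittIndex_funField_double_laurent h2n (nondeg_iterLaurent hp n)
      (nondeg_iterLaurent hq n) hdim (isDouble_iterLaurent p n) (isDouble_iterLaurent q n)).trans
      (by rw [ih, ← mul_assoc, ← pow_succ'])
end

section
/- Let F be a field of characteristic different from two, and let p and q be anisotropic forms over F of dimension at least two with 1 ∈ D_F(p). Let dim p = n and K = F(x₁,…,xₙ), the rational function field in n variables. Then q is hyperbolic over F(p) if and only if p(x₁,…,xₙ) ∈ G_K(q), i.e. the generic value p(x₁,…,xₙ) is a similarity factor of q over K. -/
set_option synthInstance.maxHeartbeats 1000000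
set_option maxHeartbeats 4000000

open scoped BigOperators Classical

namespace QF

open Matrix

section MatrixForms

theorem evalQF_mulVec {R ι : Type*} [CommRing R] [Fintype ι] {n : ℕ} (e : Fin n → R)
    (A : Matrix (Fin n) ι R) (v : ι → R) :
    evalQF e (A *ᵥ v) = v ⬝ᵥ ((Aᵀ * diagonal e * A) *ᵥ v) := by
  rw [← mulVec_mulVec, ← mulVec_mulVec, dotProduct_mulVec, vecMul_transpose]
  simp only [evalQF, dotProduct, mulVec_diagonal]
  exact Finset.sum_congr rfl fun i _ => by ring

theorem evalQF_eq_dotProduct {R : Type*} [CommRing R] {n : ℕ} (e : Fin n → R) (v : Fin n → R) :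
    evalQF e v = v ⬝ᵥ (diagonal e *ᵥ v) := by
  simpa using evalQF_mulVec e (1 : Matrix (Fin n) (Fin n) R) v

/-- A symmetric matrix whose quadratic form vanishes is zero. -/
theorem eq_zero_of_isSymm_of_dotProduct {K ι : Type*} [Field K] [Fintype ι] (h2 : (2 : K) ≠ 0)
    {M : Matrix ι ι K} (hM : Mᵀ = M) (h : ∀ v, v ⬝ᵥ (M *ᵥ v) = 0) : M = 0 := by
  have entry : ∀ i j, Pi.single i (1 : K) ⬝ᵥ (M *ᵥ Pi.single j (1 : K)) = M i j := by
    intro i j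
    simp
  ext i j
  have hij := h (Pi.single i 1 + Pi.single j 1)
  simp only [mulVec_add, dotProduct_add, add_dotProduct] at hij
  rw [h, h, entry, entry, ← congrFun (congrFun hM i) j, transpose_apply] at hij
  have : 2 * M j i = 0 := by linear_combination hij
  rw [← congrFun (congrFun hM i) j, transpose_apply]
  simpa [h2] using this

theorem transpose_mul_diagonal_mul_isSymm {R ι : Type*} [CommRing R] [Fintype ι] {n : ℕ}
    (e : Fin n → R) (A : Matrix (Fin n) ι R) :
    (Aᵀ * diagonal e * A)ᵀ = Aᵀ * diagonal e * A := by
  simp [transpose_mul, Matrix.mul_assoc]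

theorem transpose_mul_diagonal_mul_eq_zero {K ι : Type*} [Field K] [Fintype ι]
    (h2 : (2 : K) ≠ 0) {n : ℕ} {e : Fin n → K} {A : Matrix (Fin n) ι K}
    (h : ∀ v, evalQF e (A *ᵥ v) = 0) : Aᵀ * diagonal e * A = 0 :=
  eq_zero_of_isSymm_of_dotProduct h2 (transpose_mul_diagonal_mul_isSymm e A)
    fun v => by rw [← evalQF_mulVec, h]

theorem transpose_mul_diagonal_mul_eq {K : Type*} [Field K] (h2 : (2 : K) ≠ 0) {m n : ℕ}
    {e : Fin n → K} {d : Fin m → K} {A : Matrix (Fin n) (Fin m) K}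
    (h : ∀ v, evalQF e (A *ᵥ v) = evalQF d v) : Aᵀ * diagonal e * A = diagonal d := by
  refine sub_eq_zero.1 (eq_zero_of_isSymm_of_dotProduct h2 ?_ fun v => ?_)
  · rw [transpose_sub, transpose_mul_diagonal_mul_isSymm, diagonal_transpose]
  · rw [sub_mulVec, dotProduct_sub, ← evalQF_mulVec, ← evalQF_eq_dotProduct, h, sub_self]

/-- A similitude matrix with nonzero multiplier exhibits the multiplier as a similarity factor. -/
theorem mem_Gset_of_matrix {K : Type*} [Field K] {n : ℕ} {d : Fin n → K} (hd : Nondeg d) {a : K}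
    (ha : a ≠ 0) {A : Matrix (Fin n) (Fin n) K}
    (hA : Aᵀ * diagonal d * A = a • diagonal d) : a ∈ Gset d := by
  have hdet : A.det ≠ 0 := by
    intro h0
    have := congrArg Matrix.det hA
    rw [det_mul, h0, mul_zero, det_smul, det_diagonal] at this
    exact mul_ne_zero (pow_ne_zero _ ha) (Finset.prod_ne_zero_iff.2 fun i _ => hd i) this.symm
  refine ⟨ha, LinearEquiv.ofInjectiveEndo (Matrix.mulVecLin A) ?_, fun v => ?_⟩
  · exact Matrix.mulVec_injective_iff_isUnit.2 ((isUnit_iff_isUnit_det A).2 hdet.isUnit)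
  · change evalQF d (A *ᵥ v) = _
    rw [evalQF_mulVec, hA, evalQF_eq_dotProduct]
    congr 2
    ext i j
    simp [diagonal_apply, smulQF]

theorem exists_matrix_of_mem_Gset {K : Type*} [Field K] (h2 : (2 : K) ≠ 0) {n : ℕ}
    {d : Fin n → K} {a : K} (h : a ∈ Gset d) :
    ∃ A : Matrix (Fin n) (Fin n) K, Aᵀ * diagonal d * A = a • diagonal d := by
  obtain ⟨-, φ, hφ⟩ := h
  refine ⟨LinearMap.toMatrix' φ.toLinearMap, ?_⟩
  rw [transpose_mul_diagonal_mul_eq (d := smulQF a d) h2 fun v => ?_]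
  · ext i j
    simp [diagonal_apply, smulQF]
  · rw [← hφ v]
    simp

theorem evalQF_hypform_diag {R : Type*} [CommRing R] {k : ℕ} (v : Fin k → R) :
    evalQF (hypform k) (Fin.append v v) = 0 := by
  simp [evalQF, hypform, Fin.sum_univ_add, -Fin.natAdd_eq_addNat]

/-- A hyperbolic form of dimension `n` has a totally isotropic subspace of dimension `n / 2`,
spanned by the columns of `P`. -/
theorem IsHyperbolic.exists_matrix {K : Type*} [Field K] (h2 : (2 : K) ≠ 0) {n : ℕ}
    {d : Fin n → K} (h : IsHyperbolic d) :
    ∃ (k : ℕ) (P : Matrix (Fin n) (Fin k) K) (P' : Matrix (Fin k) (Fin n) K),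
      n = k + k ∧ Pᵀ * diagonal d * P = 0 ∧ P' * P = 1 := by
  obtain ⟨k, φ, hφ⟩ := h
  let ι : (Fin k → K) →ₗ[K] (Fin (k + k) → K) := LinearMap.funLeft K K (Fin.addCases id id)
  have hι : ∀ v, ι v = Fin.append v v := by
    intro v
    ext i
    refine Fin.addCases (fun j => ?_) (fun j => ?_) i <;>
      simp [ι, LinearMap.funLeft, -Fin.natAdd_eq_addNat]
  let π : (Fin (k + k) → K) →ₗ[K] (Fin k → K) := LinearMap.funLeft K K (Fin.castAdd k)
  refine ⟨k, LinearMap.toMatrix' (φ.symm.toLinearMap ∘ₗ ι),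
    LinearMap.toMatrix' (π ∘ₗ φ.toLinearMap), ?_, ?_, ?_⟩
  · simpa using φ.finrank_eq
  · refine transpose_mul_diagonal_mul_eq_zero h2 fun v => ?_
    rw [LinearMap.toMatrix'_mulVec, ← hφ]
    simp [hι, evalQF_hypform_diag]
  · rw [← LinearMap.toMatrix'_comp, ← LinearMap.toMatrix'_id]
    congr 1
    refine LinearMap.ext fun v => ?_
    ext i
    simp [hι, π, LinearMap.funLeft]

/-- A totally isotropic subspace of a nondegenerate form sits in a hyperbolic space of twice its
dimension. -/
theorem exists_dual_matrix {K ι : Type*} [Field K] [Fintype ι] (h2 : (2 : K) ≠ 0) {n : ℕ}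
    {d : Fin n → K} (hd : Nondeg d) {P : Matrix (Fin n) ι K} (hP : Pᵀ * diagonal d * P = 0)
    (hinj : Function.Injective P.mulVec) :
    ∃ Q : Matrix (Fin n) ι K, Pᵀ * diagonal d * Q = 1 ∧ Qᵀ * diagonal d * P = 1 ∧
      Qᵀ * diagonal d * Q = 0 := by
  obtain ⟨P', hP'⟩ : ∃ P' : Matrix ι (Fin n) K, P' * P = 1 := by
    obtain ⟨g, hg⟩ := P.mulVecLin.exists_leftInverse_of_injective (LinearMap.ker_eq_bot.2 hinj)
    refine ⟨LinearMap.toMatrix' g, ?_⟩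
    rw [← LinearMap.toMatrix'_id, ← hg, LinearMap.toMatrix'_comp,
      ← Matrix.toLin'_apply', LinearMap.toMatrix'_toLin']
  have hdd : diagonal d * diagonal (fun i => (d i)⁻¹) = 1 := by
    rw [diagonal_mul_diagonal, ← diagonal_one]
    congr 1
    ext i
    exact mul_inv_cancel₀ (hd i)
  let Q₀ : Matrix (Fin n) ι K := diagonal (fun i => (d i)⁻¹) * P'ᵀ
  have h1 : Pᵀ * diagonal d * Q₀ = 1 := by
    rw [Matrix.mul_assoc, ← Matrix.mul_assoc (diagonal d), hdd, Matrix.one_mul, ← transpose_mul,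
      hP', transpose_one]
  have h1' : Q₀ᵀ * diagonal d * P = 1 := by
    have := congrArg transpose h1
    simpa [transpose_mul, Matrix.mul_assoc] using this
  let S : Matrix ι ι K := Q₀ᵀ * diagonal d * Q₀
  have hS : Sᵀ = S := transpose_mul_diagonal_mul_isSymm d Q₀
  have h12 : (2⁻¹ : K) + 2⁻¹ = 1 := by field_simp; norm_num
  refine ⟨Q₀ - (2⁻¹ : K) • (P * S), ?_, ?_, ?_⟩
  · rw [Matrix.mul_sub, h1, Matrix.mul_smul, ← Matrix.mul_assoc, hP]
    simp
  · rw [transpose_sub, Matrix.sub_mul, Matrix.sub_mul, h1', transpose_smul, transpose_mul, hS,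
      Matrix.smul_mul, Matrix.smul_mul, Matrix.mul_assoc S, Matrix.mul_assoc S, hP]
    simp
  · have e1 : Q₀ᵀ * diagonal d * (P * S) = S := by rw [← Matrix.mul_assoc, h1', Matrix.one_mul]
    have e2 : S * Pᵀ * diagonal d * Q₀ = S := by
      rw [Matrix.mul_assoc S, Matrix.mul_assoc S, h1, Matrix.mul_one]
    have e3 : S * Pᵀ * diagonal d * (P * S) = 0 := by
      rw [Matrix.mul_assoc S, Matrix.mul_assoc S, ← Matrix.mul_assoc _ P, hP]
      simp
    rw [transpose_sub, transpose_smul, transpose_mul P, hS]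
    simp only [Matrix.sub_mul, Matrix.mul_sub, Matrix.smul_mul, Matrix.mul_smul, e1, e2, e3]
    change S - (2⁻¹ : K) • S - (2⁻¹ : K) • (S - (2⁻¹ : K) • 0) = 0
    rw [smul_zero, sub_zero, sub_sub, ← add_smul, h12, one_smul, sub_self]

section Dual

variable {K ι : Type*} [Field K] [Fintype ι] {n : ℕ} {d : Fin n → K} {P Q : Matrix (Fin n) ι K}

theorem evalQF_add_dual (hP : Pᵀ * diagonal d * P = 0) (hPQ : Pᵀ * diagonal d * Q = 1)
    (hQP : Qᵀ * diagonal d * P = 1) (hQ : Qᵀ * diagonal d * Q = 0) (x y : ι → K) :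
    evalQF d (P *ᵥ x + Q *ᵥ y) = 2 * (x ⬝ᵥ y) := by
  have key : ∀ (A B : Matrix (Fin n) ι K) (x y : ι → K),
      (A *ᵥ x) ⬝ᵥ (diagonal d *ᵥ (B *ᵥ y)) = x ⬝ᵥ ((Aᵀ * diagonal d * B) *ᵥ y) := by
    intro A B x y
    rw [← mulVec_mulVec, ← mulVec_mulVec, dotProduct_mulVec x, vecMul_transpose]
  rw [evalQF_eq_dotProduct, mulVec_add, dotProduct_add, add_dotProduct, add_dotProduct,
    key, key, key, key, hP, hPQ, hQP, hQ]
  simp only [zero_mulVec, one_mulVec, dotProduct_zero, dotProduct_comm y x]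
  ring

theorem injective_add_dual (hP : Pᵀ * diagonal d * P = 0) (hPQ : Pᵀ * diagonal d * Q = 1)
    (hQP : Qᵀ * diagonal d * P = 1) (hQ : Qᵀ * diagonal d * Q = 0) :
    Function.Injective (P.mulVecLin.coprod Q.mulVecLin) := by
  rw [← LinearMap.ker_eq_bot, LinearMap.ker_eq_bot']
  rintro ⟨x, y⟩ h
  simp only [LinearMap.coprod_apply, mulVecLin_apply] at h
  have hy := congrArg ((Pᵀ * diagonal d).mulVec) h
  have hx := congrArg ((Qᵀ * diagonal d).mulVec) h
  simp only [mulVec_add, mulVec_mulVec, hP, hPQ, hQP, hQ, zero_mulVec, one_mulVec, mulVec_zero,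
    zero_add, add_zero] at hx hy
  rw [hx, hy]
  rfl

end Dual

theorem two_mul_card_le_of_totally_isotropic {K ι : Type*} [Field K] [Fintype ι]
    (h2 : (2 : K) ≠ 0) {n : ℕ} {d : Fin n → K} (hd : Nondeg d) {P : Matrix (Fin n) ι K}
    (hP : Pᵀ * diagonal d * P = 0) (hinj : Function.Injective P.mulVec) :
    2 * Fintype.card ι ≤ n := by
  obtain ⟨Q, hPQ, hQP, hQ⟩ := exists_dual_matrix h2 hd hP hinj
  have := LinearMap.finrank_le_finrank_of_injective (injective_add_dual hP hPQ hQP hQ)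
  simp only [Module.finrank_prod, Module.finrank_fintype_fun_eq_card, Fintype.card_fin] at this
  omega

/-- A nondegenerate form with a totally isotropic subspace of half the dimension is
hyperbolic. -/
theorem isHyperbolic_of_totally_isotropic {K ι : Type*} [Field K] [Fintype ι]
    (h2 : (2 : K) ≠ 0) {n : ℕ} {d : Fin n → K} (hd : Nondeg d) {P : Matrix (Fin n) ι K}
    (hP : Pᵀ * diagonal d * P = 0) (hinj : Function.Injective P.mulVec)
    (hn : n = 2 * Fintype.card ι) : IsHyperbolic d := by
  obtain ⟨Q, hPQ, hQP, hQ⟩ := exists_dual_matrix h2 hd hP hinj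
  let ψ := LinearEquiv.ofInjectiveOfFinrankEq (P.mulVecLin.coprod Q.mulVecLin)
    (injective_add_dual hP hPQ hQP hQ) (by simp [hn, two_mul])
  let e := Fintype.equivFin ι
  let α : (ι → K) →ₗ[K] (Fin (Fintype.card ι + Fintype.card ι) → K) :=
    LinearMap.pi (Fin.addCases (fun i => LinearMap.proj (e.symm i))
      (fun i => LinearMap.proj (e.symm i)))
  let β : (ι → K) →ₗ[K] (Fin (Fintype.card ι + Fintype.card ι) → K) :=
    LinearMap.pi (Fin.addCases (fun i => (2⁻¹ : K) • LinearMap.proj (e.symm i))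
      (fun i => -((2⁻¹ : K) • LinearMap.proj (e.symm i))))
  have hαβ : ∀ x y, evalQF (hypform _) (α x + β y) = 2 * (x ⬝ᵥ y) := by
    intro x y
    simp only [evalQF, hypform, Fin.sum_univ_add, dotProduct, Finset.mul_sum]
    rw [← e.symm.sum_comp fun i => 2 * (x i * y i), ← Finset.sum_add_distrib]
    refine Finset.sum_congr rfl fun i _ => ?_
    simp [α, β, -Fin.natAdd_eq_addNat]
    field_simp
    ring
  have hinj' : Function.Injective (α.coprod β) := by
    rw [← LinearMap.ker_eq_bot, LinearMap.ker_eq_bot']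
    rintro ⟨x, y⟩ h
    have hl : ∀ i, x i + 2⁻¹ * y i = 0 := fun i => by
      simpa [α, β] using congrFun h (Fin.castAdd _ (e i))
    have hr : ∀ i, x i - 2⁻¹ * y i = 0 := fun i => by
      simpa [α, β, sub_eq_add_neg, -Fin.natAdd_eq_addNat] using congrFun h (Fin.natAdd _ (e i))
    have hx : x = 0 := funext fun i => by
      have : 2 * x i = 0 := by linear_combination hl i + hr i
      simpa [h2] using this
    have hy : y = 0 := funext fun i => by
      have := hl i
      rw [hx] at this
      simpa [h2] using this
    rw [hx, hy]
    rfl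
  let χ := LinearEquiv.ofInjectiveOfFinrankEq (α.coprod β) hinj' (by simp)
  refine ⟨Fintype.card ι, ψ.symm.trans χ, fun v => ?_⟩
  obtain ⟨⟨x, y⟩, rfl⟩ := ψ.surjective v
  rw [LinearEquiv.trans_apply, LinearEquiv.symm_apply_apply]
  change evalQF _ (α x + β y) = evalQF d (P *ᵥ x + Q *ᵥ y)
  rw [hαβ, evalQF_add_dual hP hPQ hQP hQ]

end MatrixForms

section RationalExtension

open MvPolynomial

theorem Anisotropic.mvPolynomial {F : Type*} [Field F] {m n : ℕ} {d : Fin n → F}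
    (hd : Anisotropic d) : Anisotropic (bc (C : F →+* MvPolynomial (Fin m) F) d) := by
  rintro ⟨v, hv, h0⟩
  let o : MonomialOrder (Fin m) := MonomialOrder.lex
  obtain ⟨i₀, hi₀⟩ := Function.ne_iff.1 hv
  obtain ⟨j, hj, hmax⟩ := Finset.exists_max_image (Finset.univ.filter fun i => v i ≠ 0)
    (fun i => o.toSyn (o.degree (v i))) ⟨i₀, by simpa using hi₀⟩
  have hle : ∀ i, o.toSyn (o.degree (v i)) ≤ o.toSyn (o.degree (v j)) := by
    intro i
    by_cases hi : v i = 0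
    · simp [hi]
    · exact hmax i (by simpa using hi)
  refine hd ⟨fun i => (v i).coeff (o.degree (v j)), fun h => ?_, ?_⟩
  · have := congrFun h j
    simp only [Finset.mem_filter, Finset.mem_univ, true_and] at hj
    exact hj (o.coeff_degree_eq_zero_iff.1 this)
  · have := congrArg (coeff (o.degree (v j) + o.degree (v j))) h0
    simp only [evalQF, bc, coeff_sum, coeff_C_mul, pow_two, coeff_zero] at this
    simp only [evalQF, pow_two]
    rw [← this]
    exact Finset.sum_congr rfl fun i _ => by
      rw [o.coeff_mul_of_add_of_degree_le (hle i) (hle i)]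

/-- An anisotropic form stays anisotropic over a rational function field. -/
theorem Anisotropic.rational {F : Type*} [Field F] {m n : ℕ} {d : Fin n → F}
    (hd : Anisotropic d) :
    Anisotropic (bc (algebraMap F (FractionRing (MvPolynomial (Fin m) F))) d) := by
  rintro ⟨v, hv, h0⟩
  obtain ⟨b, hb⟩ := IsLocalization.exist_integer_multiples_of_finite
    (nonZeroDivisors (MvPolynomial (Fin m) F)) v
  choose w hw using hb
  have hb0 : algebraMap _ (FractionRing (MvPolynomial (Fin m) F)) (b : MvPolynomial (Fin m) F)
      ≠ 0 := IsFractionRing.to_map_ne_zero_of_mem_nonZeroDivisors b.2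
  have hw' : ∀ i, algebraMap _ (FractionRing (MvPolynomial (Fin m) F)) (w i) =
      algebraMap _ _ (b : MvPolynomial (Fin m) F) * v i := fun i => by
    rw [hw, Algebra.smul_def]
  refine hd.mvPolynomial (m := m) ⟨w, fun h => hv ?_, ?_⟩
  · ext i
    have := hw' i
    rw [h, Pi.zero_apply, map_zero, eq_comm, mul_eq_zero] at this
    exact this.resolve_left hb0
  · apply IsFractionRing.injective (MvPolynomial (Fin m) F)
      (FractionRing (MvPolynomial (Fin m) F))
    simp only [evalQF, bc, map_sum, map_mul, map_pow, hw', map_zero] at h0 ⊢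
    rw [← mul_zero (algebraMap (MvPolynomial (Fin m) F)
      (FractionRing (MvPolynomial (Fin m) F)) (b : MvPolynomial (Fin m) F) ^ 2), ← h0,
      Finset.mul_sum]
    refine Finset.sum_congr rfl fun i _ => ?_
    rw [IsScalarTower.algebraMap_apply F (MvPolynomial (Fin m) F), MvPolynomial.algebraMap_eq]
    ring

end RationalExtension

section Coordinates

open Polynomial

/-- If `p` represents `1`, then after a linear change of variables its generic value is
`X ^ 2 + g` with `g` free of `X`. -/
theorem exists_ringEquiv_formPoly {F : Type*} [Field F] {m : ℕ} {p : Fin (m + 1) → F}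
    (h1 : (1 : F) ∈ Dset p) :
    ∃ (Θ : MvPolynomial (Fin (m + 1)) F ≃+* (MvPolynomial (Fin m) F)[X])
      (g : MvPolynomial (Fin m) F), (∀ a, Θ (MvPolynomial.C a) = C (MvPolynomial.C a)) ∧
        Θ (formPoly p) = X ^ 2 + C g := by
  obtain ⟨-, v, hv⟩ := h1
  obtain ⟨i₀, hi₀⟩ : ∃ i, v i ≠ 0 := by
    by_contra! h
    simp [evalQF, h] at hv
  let ℓ : MvPolynomial (Fin m) F :=
    ∑ j, MvPolynomial.C (p (i₀.succAbove j) * v (i₀.succAbove j)) * MvPolynomial.X j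
  let f : MvPolynomial (Fin (m + 1)) F →+* (MvPolynomial (Fin m) F)[X] :=
    MvPolynomial.eval₂Hom (C.comp MvPolynomial.C) (i₀.insertNth
      (C (MvPolynomial.C (v i₀)) * (X - C ℓ))
      (fun j => C (MvPolynomial.C (v (i₀.succAbove j))) * (X - C ℓ) + C (MvPolynomial.X j)))
  let y : Fin m → MvPolynomial (Fin (m + 1)) F := fun j =>
    MvPolynomial.X (i₀.succAbove j) - MvPolynomial.C (v (i₀.succAbove j) / v i₀) *
      MvPolynomial.X i₀
  let γ : MvPolynomial (Fin m) F →+* MvPolynomial (Fin (m + 1)) F :=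
    MvPolynomial.eval₂Hom MvPolynomial.C y
  let f' : (MvPolynomial (Fin m) F)[X] →+* MvPolynomial (Fin (m + 1)) F :=
    Polynomial.eval₂RingHom γ (MvPolynomial.C (v i₀)⁻¹ * MvPolynomial.X i₀ + γ ℓ)
  have hfC : ∀ a, f (MvPolynomial.C a) = C (MvPolynomial.C a) := fun a => by simp [f]
  have hf0 : f (MvPolynomial.X i₀) = C (MvPolynomial.C (v i₀)) * (X - C ℓ) := by simp [f]
  have hfj : ∀ j, f (MvPolynomial.X (i₀.succAbove j)) =
      C (MvPolynomial.C (v (i₀.succAbove j))) * (X - C ℓ) + C (MvPolynomial.X j) :=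
    fun j => by simp [f]
  have hγC : ∀ a, γ (MvPolynomial.C a) = MvPolynomial.C a := fun a => by simp [γ]
  have hγX : ∀ j, γ (MvPolynomial.X j) = y j := fun a => by simp [γ]
  have hf'C : ∀ a, f' (C a) = γ a := fun a => by simp [f']
  have hf'X : f' X = MvPolynomial.C (v i₀)⁻¹ * MvPolynomial.X i₀ + γ ℓ := by simp [f']
  have hinv : (MvPolynomial.C (v i₀) * MvPolynomial.C (v i₀)⁻¹ :
      MvPolynomial (Fin (m + 1)) F) = 1 := by
    rw [← MvPolynomial.C_mul, mul_inv_cancel₀ hi₀, MvPolynomial.C_1]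
  have hinv' : (C (MvPolynomial.C (v i₀)) * C (MvPolynomial.C (v i₀)⁻¹) :
      (MvPolynomial (Fin m) F)[X]) = 1 := by
    rw [← C_mul, ← MvPolynomial.C_mul, mul_inv_cancel₀ hi₀, MvPolynomial.C_1, C_1]
  have hy : ∀ j, f (y j) = C (MvPolynomial.X j) := by
    intro j
    simp only [y, map_sub, map_mul, hfC, hf0, hfj, div_eq_mul_inv]
    linear_combination (-C (MvPolynomial.C (v (i₀.succAbove j))) * (X - C ℓ)) * hinv'
  have hfγ : ∀ a, f (γ a) = C a := by
    intro a
    refine congrArg (fun h : MvPolynomial (Fin m) F →+* (MvPolynomial (Fin m) F)[X] => h a)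
      (?_ : f.comp γ = C)
    refine MvPolynomial.ringHom_ext' ?_ fun j => ?_
    · ext a : 1
      simp only [RingHom.comp_apply, hγC, hfC]
    · rw [RingHom.comp_apply, hγX, hy]
  let Θ : MvPolynomial (Fin (m + 1)) F ≃+* (MvPolynomial (Fin m) F)[X] :=
    RingEquiv.ofRingHom f f' (by
      refine Polynomial.ringHom_ext' (RingHom.ext fun a => ?_) ?_
      · simp only [RingHom.comp_apply, hf'C, hfγ, RingHom.id_apply]
      · simp only [RingHom.comp_apply, hf'X, map_add, map_mul, hfC, hf0, hfγ, RingHom.id_apply]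
        linear_combination (X - C ℓ) * hinv') (by
      refine MvPolynomial.ringHom_ext' ?_ fun i => ?_
      · ext a : 1
        simp only [RingHom.comp_apply, hfC, hf'C, hγC, RingHom.id_apply]
      · simp only [RingHom.comp_apply, RingHom.id_apply]
        refine i₀.succAboveCases ?_ (fun j => ?_) i
        · simp only [hf0, map_mul, map_sub, hf'C, hf'X, hγC]
          linear_combination MvPolynomial.X i₀ * hinv
        · simp only [hfj, map_add, map_mul, map_sub, hf'C, hf'X, hγC, hγX, y, div_eq_mul_inv]
          ring)
  refine ⟨Θ, (∑ j, MvPolynomial.C (p (i₀.succAbove j)) * MvPolynomial.X j ^ 2) - ℓ ^ 2, hfC, ?_⟩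
  change f (formPoly p) = _
  have hv' : p i₀ * v i₀ ^ 2 + ∑ j, p (i₀.succAbove j) * v (i₀.succAbove j) ^ 2 = 1 := by
    rw [← hv, evalQF, Fin.sum_univ_succAbove _ i₀]
  have hv'' := congrArg (fun a => (C (MvPolynomial.C a) : (MvPolynomial (Fin m) F)[X])) hv'
  simp only [map_add, map_mul, map_pow, map_sum, map_one] at hv''
  have hℓ : C ℓ = ∑ j, C (MvPolynomial.C (p (i₀.succAbove j))) *
      C (MvPolynomial.C (v (i₀.succAbove j))) * C (MvPolynomial.X j) := by
    simp only [ℓ, map_sum, map_mul]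
  have hsum : ∑ j, C (MvPolynomial.C (p (i₀.succAbove j))) *
      (C (MvPolynomial.C (v (i₀.succAbove j))) * (X - C ℓ) + C (MvPolynomial.X j)) ^ 2 =
      (∑ j, C (MvPolynomial.C (p (i₀.succAbove j))) *
        C (MvPolynomial.C (v (i₀.succAbove j))) ^ 2) * (X - C ℓ) ^ 2 +
      2 * (X - C ℓ) * (∑ j, C (MvPolynomial.C (p (i₀.succAbove j))) *
        C (MvPolynomial.C (v (i₀.succAbove j))) * C (MvPolynomial.X j)) +
      ∑ j, C (MvPolynomial.C (p (i₀.succAbove j))) * C (MvPolynomial.X j) ^ 2 := by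
    rw [Finset.sum_mul, Finset.mul_sum, ← Finset.sum_add_distrib, ← Finset.sum_add_distrib]
    exact Finset.sum_congr rfl fun j _ => by ring
  rw [formPoly, Fin.sum_univ_succAbove _ i₀]
  simp only [map_add, map_sum, map_mul, map_pow, map_sub, hfC, hf0, hfj]
  rw [hsum, ← hℓ]
  linear_combination (X - C ℓ) ^ 2 * hv''

end Coordinates

section Descent

variable {k : Type*} [Field k]

theorem re_evalQF_quadraticAlgebra (g : k) {n : ℕ} (d : Fin n → k)
    (w : Fin n → QuadraticAlgebra k (-g) 0) :
    (evalQF (bc (algebraMap k (QuadraticAlgebra k (-g) 0)) d) w).re =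
      evalQF d (fun i => (w i).re) - g * evalQF d (fun i => (w i).im) := by
  let reHom : QuadraticAlgebra k (-g) 0 →+ k := ⟨⟨QuadraticAlgebra.re, rfl⟩, fun _ _ => rfl⟩
  change reHom _ = _
  simp only [evalQF, map_sum, Finset.mul_sum]
  rw [← Finset.sum_sub_distrib]
  refine Finset.sum_congr rfl fun i _ => ?_
  change (bc (algebraMap k (QuadraticAlgebra k (-g) 0)) d i * w i ^ 2).re = _
  simp [bc, pow_two]
  ring

theorem im_evalQF_quadraticAlgebra (g : k) {n : ℕ} (d : Fin n → k)
    (w : Fin n → QuadraticAlgebra k (-g) 0) :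
    (evalQF (bc (algebraMap k (QuadraticAlgebra k (-g) 0)) d) w).im =
      2 * ∑ i, d i * (w i).re * (w i).im := by
  let imHom : QuadraticAlgebra k (-g) 0 →+ k := ⟨⟨QuadraticAlgebra.im, rfl⟩, fun _ _ => rfl⟩
  change imHom _ = _
  simp only [evalQF, map_sum, Finset.mul_sum]
  refine Finset.sum_congr rfl fun i _ => ?_
  change (bc (algebraMap k (QuadraticAlgebra k (-g) 0)) d i * w i ^ 2).im = _
  simp [bc, pow_two]
  ring

/-- If an anisotropic form over `k` has a totally isotropic subspace of half its dimension over
`k(√-g)`, then multiplication by `√-g` is realised by a skew-adjoint similitude over `k`. -/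
theorem exists_skew_similitude (h2 : (2 : k) ≠ 0) {g : k} (hg : g ≠ 0) {n r : ℕ} {d : Fin n → k}
    (hd : Anisotropic d) {P : Matrix (Fin n) (Fin r) (QuadraticAlgebra k (-g) 0)}
    {P' : Matrix (Fin r) (Fin n) (QuadraticAlgebra k (-g) 0)} (hn : n = r + r)
    (hP : Pᵀ * diagonal (bc (algebraMap k (QuadraticAlgebra k (-g) 0)) d) * P = 0)
    (hP' : P' * P = 1) :
    ∃ M : Matrix (Fin n) (Fin n) k, Mᵀ * diagonal d * M = g • diagonal d ∧
      diagonal d * M + Mᵀ * diagonal d = 0 := by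
  let ρ : (Fin r → QuadraticAlgebra k (-g) 0) →ₗ[k] (Fin n → k) :=
    { toFun := fun c i => ((P *ᵥ c) i).re
      map_add' := fun c c' => by ext i; simp [mulVec_add]
      map_smul' := fun a c => by ext i; simp [mulVec_smul] }
  let ι : (Fin r → QuadraticAlgebra k (-g) 0) →ₗ[k] (Fin n → k) :=
    { toFun := fun c i => ((P *ᵥ c) i).im
      map_add' := fun c c' => by ext i; simp [mulVec_add]
      map_smul' := fun a c => by ext i; simp [mulVec_smul] }
  have hzero : ∀ c, evalQF (bc (algebraMap k (QuadraticAlgebra k (-g) 0)) d) (P *ᵥ c) = 0 :=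
    fun c => by rw [evalQF_mulVec, hP]; simp
  have hre : ∀ c, evalQF d (ρ c) = g * evalQF d (ι c) := fun c => by
    have := re_evalQF_quadraticAlgebra g d (P *ᵥ c)
    rw [hzero] at this
    exact (sub_eq_zero.1 this.symm)
  have him : ∀ c, ∑ i, d i * ρ c i * ι c i = 0 := fun c => by
    have := im_evalQF_quadraticAlgebra g d (P *ᵥ c)
    rw [hzero] at this
    exact (mul_eq_zero.1 this.symm).resolve_left h2
  have hinj : Function.Injective ρ := by
    rw [← LinearMap.ker_eq_bot, LinearMap.ker_eq_bot']
    intro c hc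
    have hι : ι c = 0 := by
      by_contra h
      refine hd ⟨ι c, h, ?_⟩
      have := hre c
      rw [hc] at this
      simpa [evalQF, hg] using this
    have hPc : P *ᵥ c = 0 := funext fun i =>
      QuadraticAlgebra.ext (congrFun hc i) (congrFun hι i)
    rw [← one_mulVec c, ← hP', ← mulVec_mulVec, hPc, mulVec_zero]
  let e := LinearEquiv.ofInjectiveOfFinrankEq ρ hinj (by
    rw [Module.finrank_pi_fintype]
    simp [QuadraticAlgebra.finrank_eq_two, hn, mul_two])
  let B : (Fin n → k) →ₗ[k] (Fin n → k) := g • (ι ∘ₗ e.symm.toLinearMap)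
  have hB : ∀ c, B (ρ c) = g • ι c := fun c => by
    change g • ι (e.symm (e c)) = _
    rw [LinearEquiv.symm_apply_apply]
  have hsurj : ∀ v, ∃ c, ρ c = v := e.surjective
  refine ⟨LinearMap.toMatrix' B, ?_, ?_⟩
  · rw [transpose_mul_diagonal_mul_eq (d := smulQF g d) h2 fun v => ?_]
    · ext i j
      simp [diagonal_apply, smulQF]
    · obtain ⟨c, rfl⟩ := hsurj v
      rw [LinearMap.toMatrix'_mulVec, hB]
      trans g * evalQF d (ρ c)
      · rw [hre]
        simp only [evalQF, Finset.mul_sum, Pi.smul_apply, smul_eq_mul]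
        exact Finset.sum_congr rfl fun i _ => by ring
      · simp only [evalQF, smulQF, Finset.mul_sum]
        exact Finset.sum_congr rfl fun i _ => by ring
  · refine eq_zero_of_isSymm_of_dotProduct h2 ?_ fun v => ?_
    · simp [transpose_mul, add_comm]
    · obtain ⟨c, rfl⟩ := hsurj v
      rw [add_mulVec, dotProduct_add, ← mulVec_mulVec, ← mulVec_mulVec,
        dotProduct_mulVec _ (LinearMap.toMatrix' B)ᵀ, vecMul_transpose, LinearMap.toMatrix'_mulVec,
        hB]
      simp only [dotProduct, mulVec_diagonal, ← Finset.sum_add_distrib]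
      trans (2 * g) * ∑ i, d i * ρ c i * ι c i
      · rw [Finset.mul_sum]
        exact Finset.sum_congr rfl fun i _ => by
          simp only [Pi.smul_apply, smul_eq_mul]
          ring
      · rw [him, mul_zero]

theorem similitude_of_skew_similitude {R : Type*} [CommRing R] {n : ℕ} {g t : R} {d : Fin n → R}
    {M : Matrix (Fin n) (Fin n) R} (hM : Mᵀ * diagonal d * M = g • diagonal d)
    (hskew : diagonal d * M + Mᵀ * diagonal d = 0) :
    (t • 1 + M)ᵀ * diagonal d * (t • 1 + M) = (t ^ 2 + g) • diagonal d := by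
  have : (t • 1 + M)ᵀ * diagonal d * (t • 1 + M) = t ^ 2 • diagonal d +
      t • (diagonal d * M + Mᵀ * diagonal d) + Mᵀ * diagonal d * M := by
    simp only [transpose_add, transpose_smul, transpose_one, Matrix.add_mul, Matrix.mul_add,
      Matrix.smul_mul, Matrix.mul_smul, Matrix.one_mul, Matrix.mul_one, smul_add, smul_smul,
      pow_two]
    abel
  rw [this, hskew, hM, smul_zero, add_zero, add_smul]

end Descent

section FunctionField

open Polynomial

variable {F : Type*} [Field F] {m : ℕ} {p : Fin (m + 1) → F}

theorem sq_ne_neg_of_anisotropic (hm : 0 < m) (hp : Anisotropic p)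
    (Θ : MvPolynomial (Fin (m + 1)) F ≃+* (MvPolynomial (Fin m) F)[X])
    {g : MvPolynomial (Fin m) F} (hC : ∀ a, Θ (MvPolynomial.C a) = C (MvPolynomial.C a))
    (hΘ : Θ (formPoly p) = X ^ 2 + C g) (r : FractionRing (MvPolynomial (Fin m) F)) :
    r ^ 2 ≠ -algebraMap _ _ g := by
  intro hr
  let e : MvPolynomial (Fin (m + 1)) F →+* FractionRing (MvPolynomial (Fin m) F) :=
    (Polynomial.eval₂RingHom (algebraMap _ _) r).comp Θ.toRingHom
  have heC : ∀ a, e (MvPolynomial.C a) = algebraMap F _ a := fun a => by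
    change Polynomial.eval₂ _ _ (Θ _) = _
    rw [hC, Polynomial.eval₂_C,
      IsScalarTower.algebraMap_apply F (MvPolynomial (Fin m) F), MvPolynomial.algebraMap_eq]
  have hep : e (formPoly p) = 0 := by
    change Polynomial.eval₂ _ _ (Θ _) = _
    rw [hΘ]
    simp [hr]
  have hX : ∀ i, e (MvPolynomial.X i) = 0 := by
    by_contra! h
    obtain ⟨i, hi⟩ := h
    refine hp.rational (m := m) ⟨fun i => e (MvPolynomial.X i), fun h => hi (congrFun h i), ?_⟩
    rw [← hep]
    simp [evalQF, formPoly, bc, heC]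
  have he : e = ((algebraMap F _).comp (MvPolynomial.eval 0)) := by
    refine MvPolynomial.ringHom_ext (fun a => ?_) fun i => ?_
    · simp [heC]
    · simp [hX]
  have h0 := congrArg (fun f : MvPolynomial (Fin (m + 1)) F →+* _ =>
    f (Θ.symm (C (MvPolynomial.X ⟨0, hm⟩)))) he
  have h1 : e (Θ.symm (C (MvPolynomial.X ⟨0, hm⟩))) =
      algebraMap (MvPolynomial (Fin m) F) _ (MvPolynomial.X ⟨0, hm⟩) := by
    change Polynomial.eval₂ _ _ (Θ _) = _
    rw [RingEquiv.apply_symm_apply, Polynomial.eval₂_C]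
  simp only [h1, RingHom.comp_apply] at h0
  rw [IsScalarTower.algebraMap_apply F (MvPolynomial (Fin m) F), MvPolynomial.algebraMap_eq] at h0
  have h3 := IsFractionRing.injective (MvPolynomial (Fin m) F) _ h0
  have h4 := congrArg MvPolynomial.totalDegree h3
  simp at h4

/-- The point `(ω, y)` of the quadric `X ^ 2 + g = 0` over `k(√-g)`. -/
noncomputable def quadricPoint (Θ : MvPolynomial (Fin (m + 1)) F ≃+* (MvPolynomial (Fin m) F)[X])
    (g : MvPolynomial (Fin m) F) : MvPolynomial (Fin (m + 1)) F →+*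
      QuadraticAlgebra (FractionRing (MvPolynomial (Fin m) F)) (-algebraMap _ _ g) 0 :=
  (Polynomial.eval₂RingHom ((algebraMap (FractionRing (MvPolynomial (Fin m) F)) _).comp
    (algebraMap (MvPolynomial (Fin m) F) _)) QuadraticAlgebra.omega).comp Θ.toRingHom

theorem ker_quadricPoint (Θ : MvPolynomial (Fin (m + 1)) F ≃+* (MvPolynomial (Fin m) F)[X])
    {g : MvPolynomial (Fin m) F} (hΘ : Θ (formPoly p) = X ^ 2 + C g) :
    RingHom.ker (quadricPoint Θ g) = Ideal.span {formPoly p} := by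
  have hq0 : (quadricPoint Θ g) (formPoly p) = 0 := by
    change Polynomial.eval₂ _ _ (Θ _) = _
    rw [hΘ]
    ext <;> simp [pow_two]
  have hmonic : (X ^ 2 + C g).Monic := monic_X_pow_add_C g two_ne_zero
  refine le_antisymm (fun f hf => ?_) ?_
  · rw [RingHom.mem_ker] at hf
    change Polynomial.eval₂ _ _ (Θ f) = 0 at hf
    rw [Ideal.mem_span_singleton, ← map_dvd_iff Θ, hΘ,
      ← Polynomial.modByMonic_eq_zero_iff_dvd hmonic]
    obtain ⟨a, b, hab⟩ := Polynomial.exists_eq_X_add_C_of_natDegree_le_one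
      (p := Θ f %ₘ (X ^ 2 + C g)) (by
        have := Polynomial.natDegree_modByMonic_lt (Θ f) hmonic (by
          intro h
          have := congrArg Polynomial.natDegree h
          simp at this)
        rw [natDegree_X_pow_add_C] at this
        omega)
    rw [← Polynomial.modByMonic_add_div (Θ f) (X ^ 2 + C g), Polynomial.eval₂_add,
      Polynomial.eval₂_mul] at hf
    have hz : Polynomial.eval₂ ((algebraMap (FractionRing (MvPolynomial (Fin m) F)) _).comp
      (algebraMap (MvPolynomial (Fin m) F) _)) (QuadraticAlgebra.omega :
        QuadraticAlgebra (FractionRing (MvPolynomial (Fin m) F)) (-algebraMap _ _ g) 0)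
      (X ^ 2 + C g) = 0 := by
      rw [← hΘ]
      exact hq0
    rw [hz, zero_mul, add_zero, hab] at hf
    have ha := congrArg QuadraticAlgebra.im hf
    have hb := congrArg QuadraticAlgebra.re hf
    simp at ha hb
    rw [hab, ha, hb]
    simp
  · rw [Ideal.span_le, Set.singleton_subset_iff]
    exact hq0

theorem span_formPoly_isPrime (hm : 0 < m) (hp : Anisotropic p) (h1 : (1 : F) ∈ Dset p) :
    (Ideal.span {formPoly p}).IsPrime := by
  obtain ⟨Θ, g, hC, hΘ⟩ := exists_ringEquiv_formPoly h1
  have : Fact (∀ r, r ^ 2 ≠ -algebraMap _ (FractionRing (MvPolynomial (Fin m) F)) g + 0 * r) :=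
    ⟨fun r => by rw [zero_mul, add_zero]; exact sq_ne_neg_of_anisotropic hm hp Θ hC hΘ r⟩
  rw [← ker_quadricPoint Θ hΘ]
  exact RingHom.ker_isPrime _

/-- Hyperbolicity over `F(p)` makes the generic value of `p` a similarity factor. -/
theorem mem_Gset_of_isHyperbolic (hm : 0 < m) (hp : Anisotropic p) (h1 : (1 : F) ∈ Dset p)
    (h2 : (2 : F) ≠ 0) {n : ℕ} {q : Fin n → F} (hq : Nondeg q) (hqan : Anisotropic q)
    (h : IsHyperbolic (bc (algebraMap F (FunField p)) q)) :
    algebraMap _ (FractionRing (MvPolynomial (Fin (m + 1)) F)) (formPoly p) ∈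
      Gset (bc (algebraMap F (FractionRing (MvPolynomial (Fin (m + 1)) F))) q) := by
  have hprime := span_formPoly_isPrime hm hp h1
  obtain ⟨Θ, g, hC, hΘ⟩ := exists_ringEquiv_formPoly h1
  let k := FractionRing (MvPolynomial (Fin m) F)
  let K := FractionRing (MvPolynomial (Fin (m + 1)) F)
  let g' : k := algebraMap _ _ g
  have hsq := sq_ne_neg_of_anisotropic hm hp Θ hC hΘ
  have hg' : g' ≠ 0 := fun h0 => hsq 0 (by rw [show algebraMap _ k g = 0 from h0]; simp)
  have : Fact (∀ r, r ^ 2 ≠ -g' + 0 * r) :=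
    ⟨fun r => by rw [zero_mul, add_zero]; exact hsq r⟩
  let E := QuadraticAlgebra k (-g') 0
  let η : CoordRing p →+* E := Ideal.Quotient.lift _ (quadricPoint Θ g) fun a ha => by
    rwa [← ker_quadricPoint Θ hΘ] at ha
  have hη : Function.Injective η :=
    RingHom.lift_injective_of_ker_le_ideal _ _ (ker_quadricPoint Θ hΘ).le
  let φ : FunField p →+* E := IsFractionRing.lift hη
  have hφ : ∀ a, φ (algebraMap F _ a) = algebraMap k E (algebraMap F k a) := by
    intro a
    rw [IsScalarTower.algebraMap_apply F (CoordRing p), IsFractionRing.lift_algebraMap]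
    change Polynomial.eval₂ _ _ (Θ (MvPolynomial.C a)) = _
    rw [hC, Polynomial.eval₂_C, IsScalarTower.algebraMap_apply F (MvPolynomial (Fin m) F) k,
      MvPolynomial.algebraMap_eq]
    rfl
  have h2L : (2 : FunField p) ≠ 0 := by
    have := (_root_.map_ne_zero (algebraMap F (FunField p))).2 h2
    rwa [map_ofNat] at this
  have h2k : (2 : k) ≠ 0 := by
    have := (_root_.map_ne_zero (algebraMap F k)).2 h2
    rwa [map_ofNat] at this
  obtain ⟨r, P, P', hn, hP, hP'⟩ := IsHyperbolic.exists_matrix h2L h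
  obtain ⟨M, hM, hskew⟩ := exists_skew_similitude h2k hg' (hqan.rational (m := m))
    (P := P.map φ) (P' := P'.map φ) hn (by
      have := congrArg (fun A => A.map φ) hP
      simp only [Matrix.map_mul, transpose_map, diagonal_map (map_zero φ),
        Matrix.map_zero _ (map_zero φ)] at this
      rw [← this]
      congr 3
      exact funext fun i => (hφ (q i)).symm) (by
      rw [← Matrix.map_mul, hP', Matrix.map_one _ (map_zero φ) (map_one φ)])
  let j₀ : MvPolynomial (Fin m) F →+* K :=
    (algebraMap _ K).comp (Θ.symm.toRingHom.comp C)
  have hj₀ : Function.Injective j₀ :=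
    (IsFractionRing.injective _ K).comp (Θ.symm.injective.comp C_injective)
  let j : k →+* K := IsFractionRing.lift hj₀
  have hjF : ∀ a, j (algebraMap F k a) = algebraMap F K a := by
    intro a
    rw [IsScalarTower.algebraMap_apply F (MvPolynomial (Fin m) F) k, IsFractionRing.lift_algebraMap,
      IsScalarTower.algebraMap_apply F (MvPolynomial (Fin (m + 1)) F) K,
      MvPolynomial.algebraMap_eq, MvPolynomial.algebraMap_eq, ← Θ.symm_apply_apply
        (MvPolynomial.C a : MvPolynomial (Fin (m + 1)) F), hC]
    rfl
  have hd : (diagonal (bc (algebraMap F k) q)).map j = diagonal (bc (algebraMap F K) q) := by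
    rw [diagonal_map (map_zero j)]
    congr 1
    ext i
    exact hjF (q i)
  have hp' : algebraMap _ K (formPoly p) = (algebraMap _ K (Θ.symm X)) ^ 2 + j g' := by
    rw [IsFractionRing.lift_algebraMap, ← Θ.symm_apply_apply (formPoly p), hΘ]
    simp [j₀]
  refine mem_Gset_of_matrix (fun i => (_root_.map_ne_zero _).2 (hq i)) ?_
    (A := algebraMap _ K (Θ.symm X) • 1 + M.map j) ?_
  · rw [Ne, IsFractionRing.to_map_eq_zero_iff, ← Θ.map_eq_zero_iff, hΘ]
    exact (monic_X_pow_add_C g two_ne_zero).ne_zero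
  · rw [hp']
    refine similitude_of_skew_similitude ?_ ?_
    · rw [← hd, ← transpose_map, ← Matrix.map_mul, ← Matrix.map_mul, hM]
      ext a b
      simp only [Matrix.map_apply, Matrix.smul_apply, smul_eq_mul, map_mul]
      rfl
    · rw [← hd, ← transpose_map, ← Matrix.map_mul, ← Matrix.map_mul,
        ← Matrix.map_add _ (map_add j), hskew, Matrix.map_zero _ (map_zero j)]

end FunctionField

section Specialization

theorem totally_isotropic_submatrix {L ι : Type*} [Field L] [Fintype ι] {n : ℕ} {d : Fin n → L}
    {M M' : Matrix (Fin n) (Fin n) L} (hM : M' * M = 1) {g : ι → Fin n}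
    (hg : Function.Injective g) (h0 : ∀ i j, (Mᵀ * diagonal d * M) (g i) (g j) = 0) :
    (M.submatrix id g)ᵀ * diagonal d * M.submatrix id g = 0 ∧
      Function.Injective (M.submatrix id g).mulVec := by
  constructor
  · ext i j
    rw [Matrix.zero_apply, ← h0 i j]
    simp [Matrix.mul_apply, diagonal_apply]
  · have : M'.submatrix g id * M.submatrix id g = 1 := by
      rw [← submatrix_mul _ _ _ _ _ Function.bijective_id, hM, submatrix_one _ hg]
    intro v w hvw
    have hvw' := congrArg (M'.submatrix g id).mulVec hvw
    simpa only [mulVec_mulVec, this, one_mulVec] using hvw'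

variable {O : Type*} [CommRing O] [IsDomain O]

/-- Smith normal form of a similitude of a diagonal form. -/
theorem exists_smith_normal_form_of_similitude [IsPrincipalIdealRing O] {n : ℕ} {d : Fin n → O}
    (hd : Nondeg d) {t : O} (ht : t ≠ 0) {A : Matrix (Fin n) (Fin n) O}
    (hA : Aᵀ * diagonal d * A = t • diagonal d) :
    ∃ (a : Fin n → O) (B B' C C' : Matrix (Fin n) (Fin n) O), B' * B = 1 ∧ C' * C = 1 ∧
      ∀ i j, t * (Cᵀ * diagonal d * C) i j = a i * (Bᵀ * diagonal d * B) i j * a j := by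
  have hinj : Function.Injective A.mulVecLin := by
    rw [← LinearMap.ker_eq_bot, LinearMap.ker_eq_bot']
    intro v hv
    have h0 : (Aᵀ * diagonal d * A) *ᵥ v = 0 := by
      rw [← mulVec_mulVec, ← mulVecLin_apply A, hv, mulVec_zero]
    ext i
    have hi := congrFun h0 i
    rw [hA, smul_mulVec, Pi.smul_apply, mulVec_diagonal] at hi
    simpa [ht, hd i] using hi
  let e := LinearEquiv.ofInjective A.mulVecLin hinj
  obtain ⟨b, a, ab, hab⟩ := Submodule.exists_smith_normal_form_of_rank_eq
    (Pi.basisFun O (Fin n)) e.finrank_eq.symm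
  let c := ab.map e.symm
  have hc : ∀ i, A *ᵥ c i = a i • b i := fun i => by
    rw [← hab]
    exact congrArg Subtype.val (e.apply_symm_apply (ab i))
  let s := Pi.basisFun O (Fin n)
  have hAC : A * s.toMatrix c = s.toMatrix b * diagonal a := by
    ext i j
    have := congrFun (hc j) i
    rw [mul_diagonal]
    simpa [s, Matrix.mul_apply, Module.Basis.toMatrix_apply, mulVec, dotProduct, mul_comm]
      using this
  refine ⟨a, s.toMatrix b, b.toMatrix s, s.toMatrix c, c.toMatrix s,
    b.toMatrix_mul_toMatrix_flip s, c.toMatrix_mul_toMatrix_flip s, fun i j => ?_⟩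
  have key : t • ((s.toMatrix c)ᵀ * diagonal d * s.toMatrix c) =
      diagonal a * ((s.toMatrix b)ᵀ * diagonal d * s.toMatrix b) * diagonal a := by
    calc _ = (A * s.toMatrix c)ᵀ * diagonal d * (A * s.toMatrix c) := by
          rw [transpose_mul, ← Matrix.smul_mul, ← Matrix.mul_smul, ← hA]
          simp only [Matrix.mul_assoc]
      _ = _ := by
          rw [hAC, transpose_mul, diagonal_transpose]
          simp only [Matrix.mul_assoc]
  have := congrFun (congrFun key i) j
  rwa [mul_diagonal, diagonal_mul] at this

/-- If an odd power of a uniformizer `π` times a square is the multiplier of a similitude of a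
unimodular form, then the reduction of the form modulo `π` is hyperbolic. -/
theorem isHyperbolic_of_similitude [IsPrincipalIdealRing O] [ValuationRing O] {L : Type*} [Field L]
    (h2 : (2 : L) ≠ 0) (f : O →+* L) {π s : O} (hπ : f π = 0) (hmax : ∀ x, ¬IsUnit x → π ∣ x)
    (hπ0 : π ≠ 0) (hs : s ≠ 0) {n : ℕ} {d : Fin n → O} (hd : Nondeg (bc f d))
    {A : Matrix (Fin n) (Fin n) O} (hA : Aᵀ * diagonal d * A = (π * s ^ 2) • diagonal d) :
    IsHyperbolic (bc f d) := by
  obtain ⟨a, B, B', C, C', hB, hC, h⟩ := exists_smith_normal_form_of_similitude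
    (fun i hi => hd i (by rw [bc, hi, map_zero])) (mul_ne_zero hπ0 (pow_ne_zero 2 hs)) hA
  let S : Fin n → Prop := fun i => π * s ∣ a i
  have hS : ∀ i, ¬S i → a i ∣ s := by
    intro i hi
    obtain hdvd | ⟨x, hx⟩ := ValuationRing.dvd_total (a i) s
    · exact hdvd
    · by_cases hu : IsUnit x
      · rw [hx]
        exact (hu.mul_right_dvd).2 dvd_rfl
      · refine absurd ?_ hi
        change π * s ∣ a i
        rw [hx, mul_comm π]
        exact mul_dvd_mul_left s (hmax x hu)
  have hf : ∀ M : Matrix (Fin n) (Fin n) O, ∀ i j,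
      ((M.map f)ᵀ * diagonal (bc f d) * M.map f) i j = f ((Mᵀ * diagonal d * M) i j) := by
    intro M i j
    have : diagonal (bc f d) = (diagonal d).map f := (diagonal_map (map_zero f)).symm
    rw [this, ← transpose_map, ← Matrix.map_mul, ← Matrix.map_mul, Matrix.map_apply]
  have hmap : ∀ {M M' : Matrix (Fin n) (Fin n) O}, M' * M = 1 → M'.map f * M.map f = 1 :=
    fun hM => by rw [← Matrix.map_mul, hM, Matrix.map_one _ (map_zero f) (map_one f)]
  obtain ⟨hPS, hinjS⟩ := totally_isotropic_submatrix (d := bc f d) (hmap hC)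
    (Subtype.val_injective (p := S)) fun ⟨i, x, hx⟩ ⟨j, y, hy⟩ => by
      have hij := h i j
      rw [hx, hy] at hij
      have : (Cᵀ * diagonal d * C) i j = π * (x * y * (Bᵀ * diagonal d * B) i j) :=
        mul_left_cancel₀ (mul_ne_zero hπ0 (pow_ne_zero 2 hs)) (by rw [hij]; ring)
      rw [hf, this, map_mul, hπ, zero_mul]
  obtain ⟨hPT, hinjT⟩ := totally_isotropic_submatrix (d := bc f d) (hmap hB)
    (Subtype.val_injective (p := fun i => ¬S i)) fun ⟨i, hi⟩ ⟨j, hj⟩ => by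
      obtain ⟨x, hx⟩ := hS i hi
      obtain ⟨y, hy⟩ := hS j hj
      have hij := h i j
      have hai : a i ≠ 0 := fun h0 => hs (by rw [hx, h0, zero_mul])
      have haj : a j ≠ 0 := fun h0 => hs (by rw [hy, h0, zero_mul])
      have : (Bᵀ * diagonal d * B) i j = π * (x * y * (Cᵀ * diagonal d * C) i j) := by
        refine mul_left_cancel₀ (mul_ne_zero hai haj) ?_
        have hss : s ^ 2 = a i * x * (a j * y) := by rw [pow_two, ← hy, ← hx]
        rw [hss] at hij
        linear_combination -hij
      rw [hf, this, map_mul, hπ, zero_mul]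
  have hcS := two_mul_card_le_of_totally_isotropic h2 hd hPS hinjS
  have hcT := two_mul_card_le_of_totally_isotropic h2 hd hPT hinjT
  have hcard : Fintype.card {i // ¬S i} = _ - Fintype.card (Subtype S) :=
    Fintype.card_subtype_compl S
  have hle : Fintype.card (Subtype S) ≤ _ := Fintype.card_subtype_le S
  rw [Fintype.card_fin] at hcard hle
  exact isHyperbolic_of_totally_isotropic h2 hd hPS hinjS (by omega)

end Specialization

section GenericValue

/-- Clearing denominators in a similitude over the fraction field. -/
theorem exists_similitude_of_fractionRing {R : Type*} [CommRing R] [IsDomain R] {n : ℕ}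
    {d : Fin n → R} {t : R} {A : Matrix (Fin n) (Fin n) (FractionRing R)}
    (hA : Aᵀ * diagonal (bc (algebraMap R (FractionRing R)) d) * A =
      algebraMap R (FractionRing R) t • diagonal (bc (algebraMap R (FractionRing R)) d)) :
    ∃ (s : R) (B : Matrix (Fin n) (Fin n) R), s ≠ 0 ∧
      Bᵀ * diagonal d * B = (t * s ^ 2) • diagonal d := by
  obtain ⟨s, hs⟩ := IsLocalization.exist_integer_multiples_of_finite (nonZeroDivisors R)
    fun ij : Fin n × Fin n => A ij.1 ij.2
  choose w hw using hs
  have hB : (of fun i j => w (i, j)).map (algebraMap R (FractionRing R)) =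
      algebraMap R (FractionRing R) s • A := by
    ext i j
    rw [Matrix.map_apply, of_apply, hw, Matrix.smul_apply, Algebra.smul_def, smul_eq_mul]
  have hd : diagonal (bc (algebraMap R (FractionRing R)) d) = (diagonal d).map (algebraMap R _) :=
    (diagonal_map (map_zero _)).symm
  refine ⟨s, of fun i j => w (i, j), nonZeroDivisors.ne_zero s.2,
    Matrix.map_injective (IsFractionRing.injective R (FractionRing R)) ?_⟩
  beta_reduce
  rw [Matrix.map_mul, Matrix.map_mul, transpose_map, hB, ← hd, transpose_smul, Matrix.smul_mul,
    Matrix.smul_mul, Matrix.mul_smul, hA, hd]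
  ext i j
  simp only [Matrix.smul_apply, Matrix.map_apply, smul_eq_mul, map_mul, map_pow]
  ring

/-- If the generic value of `p` is a similarity factor, then `q` is hyperbolic over `F(p)`. -/
theorem isHyperbolic_of_mem_Gset {F : Type*} [Field F] (h2 : (2 : F) ≠ 0) {m n : ℕ}
    {p : Fin m → F} (hprime : (Ideal.span {formPoly p}).IsPrime) {q : Fin n → F} (hq : Nondeg q)
    (h : algebraMap _ (FractionRing (MvPolynomial (Fin m) F)) (formPoly p) ∈
      Gset (bc (algebraMap F (FractionRing (MvPolynomial (Fin m) F))) q)) :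
    IsHyperbolic (bc (algebraMap F (FunField p)) q) := by
  let R := MvPolynomial (Fin m) F
  let O := Localization.AtPrime (Ideal.span {formPoly p})
  have h2K : (2 : FractionRing R) ≠ 0 := by
    have := (_root_.map_ne_zero (algebraMap F (FractionRing R))).2 h2
    rwa [map_ofNat] at this
  have h2L : (2 : FunField p) ≠ 0 := by
    have := (_root_.map_ne_zero (algebraMap F (FunField p))).2 h2
    rwa [map_ofNat] at this
  obtain ⟨A, hA⟩ := exists_matrix_of_mem_Gset h2K h
  have hπ : formPoly p ≠ 0 := fun h0 => h.1 (by rw [h0, map_zero])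
  have hbcK : bc (algebraMap F (FractionRing R)) q =
      bc (algebraMap R (FractionRing R)) (bc (algebraMap F R) q) :=
    funext fun i => IsScalarTower.algebraMap_apply F R (FractionRing R) (q i)
  rw [hbcK] at hA
  obtain ⟨s, B, hs, hB⟩ := exists_similitude_of_fractionRing hA
  have hinj : Function.Injective (algebraMap R O) :=
    IsLocalization.injective O (Ideal.span {formPoly p}).primeCompl_le_nonZeroDivisors
  have : IsNoetherianRing O :=
    IsLocalization.isNoetherianRing (Ideal.span {formPoly p}).primeCompl O inferInstance
  have hmax : IsLocalRing.maximalIdeal O = Ideal.span {algebraMap R O (formPoly p)} := by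
    rw [← Localization.AtPrime.map_eq_maximalIdeal, Ideal.map_span, Set.image_singleton]
  have htfae := tfae_of_isNoetherianRing_of_isLocalRing_of_isDomain (R := O)
  have hprinc : (IsLocalRing.maximalIdeal O).IsPrincipal := ⟨⟨_, hmax⟩⟩
  have : IsPrincipalIdealRing O := (htfae.out 0 4).2 hprinc
  have : ValuationRing O := (htfae.out 1 4).2 hprinc
  have hunit : ∀ y : (Ideal.span {formPoly p}).primeCompl,
      IsUnit (algebraMap R (FunField p) y) := fun y => by
    rw [isUnit_iff_ne_zero, IsScalarTower.algebraMap_apply R (CoordRing p), Ne,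
      IsFractionRing.to_map_eq_zero_iff]
    exact fun h0 => y.2 (Ideal.Quotient.eq_zero_iff_mem.1 h0)
  let f : O →+* FunField p := IsLocalization.lift hunit
  have hf : ∀ x, f (algebraMap R O x) = algebraMap R (FunField p) x := fun x =>
    IsLocalization.lift_eq hunit x
  have hbcL : bc (algebraMap F (FunField p)) q = bc f (bc (algebraMap F O) q) :=
    funext fun i => by
      rw [bc, bc, bc, IsScalarTower.algebraMap_apply F R O, hf,
        ← IsScalarTower.algebraMap_apply F R (FunField p)]
  have hd : (diagonal (bc (algebraMap F R) q)).map (algebraMap R O) =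
      diagonal (bc (algebraMap F O) q) := by
    rw [diagonal_map (map_zero _)]
    exact congrArg diagonal (funext fun i => (IsScalarTower.algebraMap_apply F R O (q i)).symm)
  have hqL : Nondeg (bc (algebraMap F (FunField p)) q) :=
    fun i => (_root_.map_ne_zero _).2 (hq i)
  rw [hbcL] at hqL ⊢
  refine isHyperbolic_of_similitude h2L f (π := algebraMap R O (formPoly p))
    (s := algebraMap R O s) ?_ (fun x hx => ?_) ?_ ?_ hqL (A := B.map (algebraMap R O)) ?_
  · rw [hf, IsScalarTower.algebraMap_apply R (CoordRing p)]
    refine (congrArg _ ?_).trans (map_zero _)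
    exact Ideal.Quotient.eq_zero_iff_mem.2 (Ideal.mem_span_singleton_self _)
  · rw [← Ideal.mem_span_singleton, ← hmax]
    exact hx
  · exact (map_ne_zero_iff _ hinj).2 hπ
  · exact (map_ne_zero_iff _ hinj).2 hs
  · rw [← hd, ← transpose_map, ← Matrix.map_mul, ← Matrix.map_mul, hB]
    ext i j
    simp only [Matrix.smul_apply, Matrix.map_apply, smul_eq_mul, map_mul, map_pow]

end GenericValue

end QF


open QF in
/-- Knebusch's characterisation: let `p`, `q` be anisotropic forms over `F` (char `F ≠ 2`) of
dimension at least two with `1 ∈ D_F(p)`, `dim p = n`, and `K = F(x₁,…,xₙ)` the rational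
function field. Then `q` is hyperbolic over `F(p)` if and only if
`p(x₁,…,xₙ) ∈ G_K(q)`. -/
theorem stmt_14 {F : Type*} [Field F] (h2 : (2 : F) ≠ 0)
    {np nq : ℕ} (p : Fin np → F) (q : Fin nq → F)
    (hp : Nondeg p) (hq : Nondeg q) (hp2 : 2 ≤ np) (hq2 : 2 ≤ nq)
    (hpan : Anisotropic p) (hqan : Anisotropic q) (h1 : (1 : F) ∈ Dset p) :
    IsHyperbolic (bc (algebraMap F (FunField p)) q)
      ↔ algebraMap (MvPolynomial (Fin np) F) (FractionRing (MvPolynomial (Fin np) F))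
            (formPoly p)
          ∈ Gset (bc (algebraMap F (FractionRing (MvPolynomial (Fin np) F))) q) := by
  obtain ⟨m, rfl⟩ : ∃ m, np = m + 1 := ⟨np - 1, by omega⟩
  have hm : 0 < m := by omega
  exact ⟨mem_Gset_of_isHyperbolic hm hpan h1 h2 hq hqan,
    isHyperbolic_of_mem_Gset h2 (span_formPoly_isPrime hm hpan h1) hq⟩
end
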